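/- arXiv:1911.11613 — 2 statements merged into one kernel-verified Lean document; each statement's English description precedes it below -/
import Mathlib

section
/- Let ρ>0 and β>0. Then the entire function λ_{ρ,β}(z)=Γ(β)·W_{ρ,β}(−z²) has infinitely many zeros, all of which are real, and it admits the infinite product representation Γ(β)·W_{ρ,β}(−z²)=∏_{n≥1}(1−z²/ζ_n²) for all z∈ℂ, where 0<ζ₁<ζ₂<⋯ are the positive zeros of λ_{ρ,β} arranged in increasing order. -/
open Complex Filter Set

/-- The Wright function `W_{ρ,β}(z) = ∑ z^n / (n! Γ(ρn+β))`. -/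
noncomputable def wright (ρ β : ℝ) (z : ℂ) : ℂ :=
  ∑' n : ℕ, z ^ n / ((n.factorial : ℂ) * Complex.Gamma ((ρ * n + β : ℝ) : ℂ))

/-- `λ_{ρ,β}(z) = Γ(β) · W_{ρ,β}(−z²)`. -/
noncomputable def lam (ρ β : ℝ) (z : ℂ) : ℂ :=
  Complex.Gamma ((β : ℝ) : ℂ) * wright ρ β (-z ^ 2)

/-- The normalized Wright function `g_{ρ,β}(z) = z · Γ(β) · W_{ρ,β}(−z²)`. -/
noncomputable def gw (ρ β : ℝ) (z : ℂ) : ℂ := z * lam ρ β z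

/-- The normalized Wright function `h_{ρ,β}(z) = z · Γ(β) · W_{ρ,β}(−z)`. -/
noncomputable def hw (ρ β : ℝ) (z : ℂ) : ℂ :=
  z * Complex.Gamma ((β : ℝ) : ℂ) * wright ρ β (-z)

/-- The normalized Wright function
`f_{ρ,β}(z) = z · exp((1/β) · Log(Γ(β) · W_{ρ,β}(−z²)))` (principal branch). -/
noncomputable def fw (ρ β : ℝ) (z : ℂ) : ℂ :=
  z * Complex.exp ((1 / (β : ℂ)) * Complex.log (lam ρ β z))


open Topology Polynomial

namespace WrightAux

/-- being a negative real -/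
def NegReal (z : ℂ) : Prop := z.im = 0 ∧ z.re < 0

lemma sum_aux_im (z : ℂ) (hz : z.im ≠ 0) (s : Multiset ℂ) (hs : ∀ r ∈ s, NegReal r) :
    s = 0 ∨ 0 < z.im * (s.map fun r => z * (1 / (z - r))).sum.im := by
  induction s using Multiset.induction with
  | empty => left; rfl
  | cons a s ih =>
    right
    have ha := hs a (Multiset.mem_cons_self a s)
    have h1 : 0 < z.im * (z * (1 / (z - a))).im := by
      have hne : 0 < normSq (z - a) := by
        rw [normSq_pos]
        intro h
        have : z.im - a.im = 0 := by simpa using congrArg Complex.im h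
        rw [ha.1] at this
        exact hz (by linarith)
      have : z.im * (z * (1 / (z - a))).im = (z.im ^ 2 * (-a.re)) / normSq (z - a) := by
        simp only [one_div, mul_im, inv_im, inv_re, sub_im, sub_re, ha.1]
        field_simp
        ring
      rw [this]
      have := ha.2
      have h3 : 0 < z.im ^ 2 := by positivity
      apply div_pos _ hne
      apply mul_pos h3; linarith
    rw [Multiset.map_cons, Multiset.sum_cons, add_im, mul_add]
    rcases ih (fun r hr => hs r (Multiset.mem_cons_of_mem hr)) with h | h
    · subst h; simpa using h1
    · linarith

lemma sum_aux_re (z : ℂ) (hz : z.im = 0) (hz' : 0 ≤ z.re) (s : Multiset ℂ)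
    (hs : ∀ r ∈ s, NegReal r) :
    0 ≤ (s.map fun r => z * (1 / (z - r))).sum.re := by
  induction s using Multiset.induction with
  | empty => simp
  | cons a s ih =>
    have ha := hs a (Multiset.mem_cons_self a s)
    have h1 : 0 ≤ (z * (1 / (z - a))).re := by
      have : (z * (1 / (z - a))).re = (z.re * (z.re - a.re)) / normSq (z - a) := by
        simp only [one_div, mul_re, inv_im, inv_re, sub_im, sub_re, ha.1, hz]
        field_simp
        ring
      rw [this]
      have := ha.2
      apply div_nonneg _ (normSq_nonneg _)
      apply mul_nonneg hz'; linarith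
    rw [Multiset.map_cons, Multiset.sum_cons, add_re]
    have := ih (fun r hr => hs r (Multiset.mem_cons_of_mem hr))
    linarith

lemma roots_step (p : ℂ[X]) (h : ∀ z, p.eval z = 0 → NegReal z) (c ρ : ℝ)
    (hc : 0 < c) (hρ : 0 < ρ) (z : ℂ)
    (hz : (C (c : ℂ) * p + C (ρ : ℂ) * (X * derivative p)).eval z = 0) : NegReal z := by
  by_contra hneg
  have hpz : p.eval z ≠ 0 := fun h' => hneg (h z h')
  have hp0 : p ≠ 0 := by rintro rfl; simp at hpz
  have hsp : p.Splits := IsAlgClosed.splits p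
  have hd := hsp.eval_derivative_eq_eval_mul_sum hpz
  have hroots : ∀ r ∈ p.roots, NegReal r := fun r hr => h r ((mem_roots hp0).1 hr)
  simp only [eval_add, eval_mul, eval_C, eval_X, hd] at hz
  have hS : (c : ℂ) + ρ * (p.roots.map fun r => z * (1 / (z - r))).sum = 0 := by
    rw [Multiset.sum_map_mul_left]
    have : p.eval z * ((c : ℂ) + ρ * (z * (p.roots.map fun r => (1 / (z - r))).sum)) = 0 := by
      rw [← hz]; ring
    exact (mul_eq_zero.1 this).resolve_left hpz
  by_cases him : z.im = 0
  · have hre : 0 ≤ z.re := by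
      by_contra h'
      exact hneg ⟨him, not_le.1 h'⟩
    have h1 := sum_aux_re z him hre p.roots hroots
    have h2 := congrArg Complex.re hS
    simp only [add_re, ofReal_re, re_ofReal_mul, zero_re] at h2
    have := mul_nonneg hρ.le h1
    linarith
  · rcases sum_aux_im z him p.roots hroots with h1 | h1
    · rw [h1] at hS
      simp at hS
      exact hc.ne' hS
    · have h2 := congrArg Complex.im hS
      simp only [add_im, ofReal_im, im_ofReal_mul, zero_im, zero_add] at h2
      rcases mul_eq_zero.1 h2 with h3 | h3
      · exact hρ.ne' h3
      · rw [h3] at h1; simp at h1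

lemma exists_poly (ρ β : ℝ) (hρ : 0 < ρ) (hβ : 0 < β) (m k : ℕ) :
    ∃ p : ℂ[X], (∀ n, p.coeff n =
      (((m.choose n : ℝ) * ∏ i ∈ Finset.range k, (β + ρ * n + i) : ℝ) : ℂ)) ∧
      ∀ z, p.eval z = 0 → NegReal z := by
  induction k with
  | zero =>
    refine ⟨(1 + X) ^ m, fun n => ?_, fun z hz => ?_⟩
    · rw [coeff_one_add_X_pow]; simp
    · simp only [eval_pow, eval_add, eval_one, eval_X] at hz
      have h1 : 1 + z = 0 := eq_zero_of_pow_eq_zero hz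
      have : z = -1 := by linear_combination h1
      subst this
      constructor <;> simp
  | succ k ih =>
    obtain ⟨p, hp, hr⟩ := ih
    refine ⟨C ((β + k : ℝ) : ℂ) * p + C (ρ : ℂ) * (X * derivative p), fun n => ?_, fun z hz => 
      roots_step p hr (β + k) ρ (by positivity) hρ z hz⟩
    rw [coeff_add, coeff_C_mul, coeff_C_mul, Finset.prod_range_succ]
    have : (X * derivative p).coeff n = n * p.coeff n := by
      cases n with
      | zero => simp
      | succ n => rw [coeff_X_mul, coeff_derivative]; push_cast; ring
    rw [this, hp]
    push_cast
    ring

lemma poly_factor (p : ℂ[X]) (h : ∀ z, p.eval z = 0 → NegReal z) :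
    ∃ (u : ℕ → ℝ) (d : ℕ), Antitone u ∧ (∀ j, 0 ≤ u j) ∧ (∀ j, d ≤ j → u j = 0) ∧
      ∀ z, p.eval z = p.eval 0 * ∏ j ∈ Finset.range d, (1 + z * u j) := by
  have hp0 : p ≠ 0 := by
    rintro rfl
    have := (h 0 (by simp)).2
    simp at this
  have hsp : p.Splits := IsAlgClosed.splits p
  have hroots : ∀ r ∈ p.roots, NegReal r := fun r hr => h r ((mem_roots hp0).1 hr)
  set s : Multiset ℝ := p.roots.map (fun r => - 1 / r.re) with hs
  have hspos : ∀ x ∈ s, 0 ≤ x := by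
    intro x hx
    obtain ⟨r, hr, rfl⟩ := Multiset.mem_map.1 hx
    have := (hroots r hr).2
    rw [neg_div, ← div_neg]
    apply div_nonneg zero_le_one; linarith
  set l : List ℝ := s.sort (fun a b => b ≤ a) with hl
  have hlp : l.Pairwise (fun a b => b ≤ a) := Multiset.pairwise_sort _ _
  have hlpos : ∀ x ∈ l, 0 ≤ x := fun x hx => hspos x ((Multiset.mem_sort _).1 hx)
  have hnn : ∀ j, 0 ≤ l.getD j 0 := by
    intro j
    by_cases hj : j < l.length
    · rw [List.getD_eq_getElem _ _ hj]; exact hlpos _ (List.getElem_mem hj)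
    · rw [List.getD_eq_default _ _ (not_lt.1 hj)]
  refine ⟨fun j => l.getD j 0, l.length, ?_, hnn, ?_, ?_⟩
  · intro i j hij
    by_cases hj : j < l.length
    · rcases hij.eq_or_lt with rfl | hij'
      · exact le_rfl
      · simp only
        rw [List.getD_eq_getElem _ _ hj, List.getD_eq_getElem _ _ (hij.trans_lt hj)]
        exact List.pairwise_iff_getElem.1 hlp i j _ _ hij'
    · simp only
      rw [List.getD_eq_default _ _ (not_lt.1 hj)]; exact hnn i
  · intro j hj
    exact List.getD_eq_default _ _ hj
  · intro z
    have h1 : ∏ j ∈ Finset.range l.length, (1 + z * ((l.getD j 0 : ℝ) : ℂ)) =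
        (s.map (fun x : ℝ => 1 + z * (x : ℂ))).prod := by
      have : (s.map (fun x : ℝ => 1 + z * (x : ℂ))).prod = (l.map (fun x : ℝ => 1 + z * (x : ℂ))).prod := by
        rw [← Multiset.sort_eq s (fun a b => b ≤ a), Multiset.map_coe, Multiset.prod_coe]
      rw [this, ← Fin.prod_univ_eq_prod_range (fun j => (1 + z * ((l.getD j 0 : ℝ) : ℂ)))]
      rw [← Fin.prod_univ_fun_getElem]
      refine Finset.prod_congr rfl fun i _ => ?_
      rw [List.getD_eq_getElem _ _ i.2]
    rw [h1, hsp.eval_eq_prod_roots z, hsp.eval_eq_prod_roots 0, hs, Multiset.map_map, mul_assoc,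
      ← Multiset.prod_map_mul]
    congr 2
    refine Multiset.map_congr rfl fun r hr => ?_
    have hr' := hroots r hr
    have hre : (r.re : ℂ) = r := Complex.ext (by simp) (by simp [hr'.1])
    have hr0 : r ≠ 0 := by
      rintro rfl
      have := hr'.2
      simp at this
    simp only [Function.comp]
    push_cast
    rw [hre]
    field_simp
    ring

lemma sum_le_prod_one_add (u : ℕ → ℝ) (hu : ∀ j, 0 ≤ u j) (n : ℕ) :
    1 + ∑ j ∈ Finset.range n, u j ≤ ∏ j ∈ Finset.range n, (1 + u j) := by
  induction n with
  | zero => simp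
  | succ n ih =>
    rw [Finset.sum_range_succ, Finset.prod_range_succ]
    have h1 : 0 ≤ ∑ j ∈ Finset.range n, u j := Finset.sum_nonneg fun j _ => hu j
    nlinarith [hu n]

lemma norm_fac_le (w : ℂ) : ‖(1 + w) * cexp (-w) - 1‖ ≤ ‖w‖ ^ 2 * Real.exp (2 * ‖w‖) := by
  have h1 : (1 + w) * cexp (-w) - 1 = - (cexp (-w) * (cexp w - ∑ m ∈ Finset.range 2, w ^ m / m.factorial)) := by
    have : cexp (-w) * cexp w = 1 := by rw [← Complex.exp_add]; simp
    simp [Finset.sum_range_succ]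
    linear_combination this
  rw [h1, norm_neg, norm_mul]
  have h2 := Complex.norm_exp_sub_sum_le_norm_mul_exp w 2
  have h3 : ‖cexp (-w)‖ ≤ Real.exp ‖w‖ := by
    have := Complex.norm_exp_le_exp_norm (-w)
    rwa [norm_neg] at this
  calc _ ≤ Real.exp ‖w‖ * (‖w‖ ^ 2 * Real.exp ‖w‖) := by gcongr
    _ = _ := by rw [two_mul, Real.exp_add]; ring

lemma lp_limit (u : ℕ → ℕ → ℝ) (d : ℕ → ℕ) (hanti : ∀ k, Antitone (u k))
    (hnn : ∀ k j, 0 ≤ u k j) (hz : ∀ k j, d k ≤ j → u k j = 0) (F : ℂ → ℂ)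
    (hF : ∀ z : ℂ, Tendsto (fun k => ∏ j ∈ Finset.range (d k), (1 + z * u k j)) atTop (𝓝 (F z))) :
    ∃ (v : ℕ → ℝ) (c : ℝ), Antitone v ∧ (∀ j, 0 ≤ v j) ∧ 0 ≤ c ∧ Summable v ∧
      ∀ z, F z = cexp (c * z) * ∏' j, (1 + z * v j) := by
  obtain ⟨S, hS⟩ := (hF 1).norm.bddAbove_range
  set s : ℕ → ℝ := fun k => ∑ j ∈ Finset.range (d k), u k j with hs
  have hs0 : ∀ k, 0 ≤ s k := fun k => Finset.sum_nonneg fun j _ => hnn k j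
  have hsS : ∀ k, s k ≤ S := by
    intro k
    have h1 : ‖∏ j ∈ Finset.range (d k), (1 + (1 : ℂ) * u k j)‖ ≤ S := hS ⟨k, rfl⟩
    have h2 : ∏ j ∈ Finset.range (d k), (1 + (1 : ℂ) * u k j) =
        ((∏ j ∈ Finset.range (d k), (1 + u k j) : ℝ) : ℂ) := by push_cast; simp
    rw [h2, Complex.norm_real, Real.norm_eq_abs] at h1
    have h3 := le_abs_self (∏ j ∈ Finset.range (d k), (1 + u k j))
    have h4 := sum_le_prod_one_add (u k) (hnn k) (d k)
    simp only [hs]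
    linarith
  have hS0 : 0 ≤ S := (hs0 0).trans (hsS 0)
  have hpart : ∀ k n, ∑ j ∈ Finset.range n, u k j ≤ s k := by
    intro k n
    rcases le_total n (d k) with h | h
    · exact Finset.sum_le_sum_of_subset_of_nonneg (Finset.range_subset_range.2 h) fun j _ _ => hnn k j
    · simp only [hs]
      rw [← Finset.sum_subset (Finset.range_subset_range.2 h)]
      intro j _ hj
      exact hz k j (by simpa using hj)
  have hub : ∀ k j, u k j ≤ S / (j + 1) := by
    intro k j
    rw [le_div_iff₀ (by positivity)]
    have h1 : ∑ i ∈ Finset.range (j + 1), u k j ≤ ∑ i ∈ Finset.range (j + 1), u k i :=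
      Finset.sum_le_sum fun i hi => hanti k (by simpa [Nat.lt_succ_iff] using hi)
    rw [Finset.sum_const, Finset.card_range, nsmul_eq_mul] at h1
    have := (h1.trans (hpart k _)).trans (hsS k)
    push_cast at this
    linarith
  have huS : ∀ k j, u k j ≤ S := fun k j => by
    refine (hub k j).trans (div_le_self hS0 ?_)
    have : (0 : ℝ) ≤ j := by positivity
    linarith
  have hK : IsCompact (Set.pi Set.univ (fun _ : ℕ => Set.Icc (0 : ℝ) S)) :=
    isCompact_univ_pi fun _ => isCompact_Icc
  obtain ⟨v, hv, φ, hφ, hφv⟩ := hK.tendsto_subseq (x := u) (fun k j _ => ⟨hnn k j, huS k j⟩)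
  obtain ⟨t, ht, ψ, hψ, hψt⟩ := (isCompact_Icc (a := (0 : ℝ)) (b := S)).tendsto_subseq
    (x := s ∘ φ) (fun k => ⟨hs0 _, hsS _⟩)
  set θ : ℕ → ℕ := φ ∘ ψ with hθ
  have hθt : Tendsto θ atTop atTop := hφ.tendsto_atTop.comp hψ.tendsto_atTop
  have huv : ∀ j, Tendsto (fun k => u (θ k) j) atTop (𝓝 (v j)) := by
    intro j
    exact ((tendsto_pi_nhds.1 hφv j).comp hψ.tendsto_atTop)
  have hst : Tendsto (fun k => s (θ k)) atTop (𝓝 t) := hψt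
  have hvanti : Antitone v := fun i j hij =>
    le_of_tendsto_of_tendsto' (huv j) (huv i) fun k => hanti _ hij
  have hv0 : ∀ j, 0 ≤ v j := fun j => (hv j (Set.mem_univ j)).1
  have hvsum : ∀ n, ∑ j ∈ Finset.range n, v j ≤ t := fun n =>
    le_of_tendsto_of_tendsto' (tendsto_finsetSum _ fun j _ => huv j) hst fun k => hpart _ n
  have hvS : Summable v := summable_of_sum_range_le hv0 hvsum
  have hvt : ∑' j, v j ≤ t := Real.tsum_le_of_sum_range_le hv0 hvsum
  refine ⟨v, t - ∑' j, v j, hvanti, hv0, by linarith, hvS, fun z => ?_⟩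
  have hlim1 : Tendsto (fun k => ∏' j, (1 + ((1 + z * u (θ k) j) * cexp (-(z * u (θ k) j)) - 1))) atTop
      (𝓝 (∏' j, (1 + ((1 + z * v j) * cexp (-(z * v j)) - 1)))) := by
    apply tendsto_tprod_one_add_of_dominated_convergence
      (bound := fun j : ℕ => (‖z‖ * S) ^ 2 * Real.exp (2 * (‖z‖ * S)) * (1 / ((j + 1 : ℕ) : ℝ) ^ 2))
    · apply Summable.mul_left
      exact (summable_nat_add_iff 1).2 (Real.summable_one_div_nat_pow.2 one_lt_two)
    · intro j
      have h1 : Tendsto (fun k => z * ((u (θ k) j : ℝ) : ℂ)) atTop (𝓝 (z * (v j : ℂ))) :=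
        ((Complex.continuous_ofReal.tendsto _).comp (huv j)).const_mul z
      exact ((h1.const_add 1).mul ((Complex.continuous_exp.tendsto _).comp h1.neg)).sub_const 1
    · refine Eventually.of_forall fun k j => (norm_fac_le _).trans ?_
      have h1 : ‖z * (u (θ k) j : ℂ)‖ = ‖z‖ * u (θ k) j := by
        rw [norm_mul, Complex.norm_real, Real.norm_of_nonneg (hnn _ _)]
      rw [h1]
      have h2 : ‖z‖ * u (θ k) j ≤ ‖z‖ * S := mul_le_mul_of_nonneg_left (huS _ _) (norm_nonneg _)
      have h3 : (‖z‖ * u (θ k) j) ^ 2 ≤ (‖z‖ * (S / (j + 1))) ^ 2 := by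
        have := hnn (θ k) j
        have := hub (θ k) j
        gcongr
      calc _ ≤ (‖z‖ * (S / (j + 1))) ^ 2 * Real.exp (2 * (‖z‖ * S)) := by gcongr
        _ = _ := by push_cast; field_simp
  have hlim2 : Tendsto (fun k => ∏' j, (1 + ((1 + z * u (θ k) j) * cexp (-(z * u (θ k) j)) - 1))) atTop
      (𝓝 (F z * cexp (-(z * t)))) := by
    have h1 : ∀ k, ∏' j, (1 + ((1 + z * u (θ k) j) * cexp (-(z * u (θ k) j)) - 1)) =
        (∏ j ∈ Finset.range (d (θ k)), (1 + z * u (θ k) j)) * cexp (-(z * (s (θ k) : ℂ))) := by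
      intro k
      rw [tprod_eq_prod (s := Finset.range (d (θ k)))]
      · simp only [add_sub_cancel, Finset.prod_mul_distrib, ← Complex.exp_sum]
        congr 2
        simp only [hs]
        push_cast
        rw [Finset.sum_neg_distrib, Finset.mul_sum]
      · intro j hj
        rw [hz _ j (by simpa using hj)]
        simp
    simp_rw [h1]
    exact ((hF z).comp hθt).mul ((Complex.continuous_exp.tendsto _).comp
      (((Complex.continuous_ofReal.tendsto _).comp hst).const_mul z).neg)
  have heq := tendsto_nhds_unique hlim2 hlim1
  have hm1 : Multipliable fun j => 1 + z * (v j : ℂ) := by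
    apply multipliable_one_add_of_summable
    simp_rw [norm_mul, Complex.norm_real, Real.norm_of_nonneg (hv0 _)]
    exact hvS.mul_left _
  have hm2 : HasProd (fun j => cexp (-(z * (v j : ℂ)))) (cexp (-(z * (∑' j, v j : ℝ)))) := by
    have : HasSum (fun j => -(z * (v j : ℂ))) (-(z * (∑' j, v j : ℝ))) := by
      apply HasSum.neg
      apply HasSum.mul_left
      exact Complex.hasSum_ofReal.2 hvS.hasSum
    exact this.cexp
  simp only [add_sub_cancel] at heq
  rw [(hm1.hasProd.mul hm2).tprod_eq] at heq
  have he : cexp (-(z * t)) * cexp (z * t) = 1 := by rw [← Complex.exp_add]; simp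
  calc F z = (F z * cexp (-(z * t))) * cexp (z * t) := by rw [mul_assoc, he, mul_one]
    _ = _ := by
      rw [heq, mul_assoc, ← Complex.exp_add, mul_comm]
      congr 2
      push_cast
      ring

/-- normalized Wright coefficients -/
noncomputable def wc (ρ β : ℝ) (n : ℕ) : ℝ := Real.Gamma β / (n.factorial * Real.Gamma (β + ρ * n))

/-- normalized Wright function -/
noncomputable def FF (ρ β : ℝ) (z : ℂ) : ℂ := ∑' n : ℕ, (wc ρ β n : ℂ) * z ^ n

/-- coefficients of the approximating polynomials -/
noncomputable def ac (ρ β : ℝ) (k n : ℕ) : ℝ :=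
  (k.choose n : ℝ) * (∏ i ∈ Finset.range (k + 1), (β + ρ * n + i)) /
    (∏ i ∈ Finset.range (k + 1), (β + i)) * (1 / (k * (k : ℝ) ^ ρ)) ^ n

lemma wc_pos (ρ β : ℝ) (hρ : 0 < ρ) (hβ : 0 < β) (n : ℕ) : 0 < wc ρ β n := by
  unfold wc
  have h1 := Real.Gamma_pos_of_pos hβ
  have h2 : 0 < Real.Gamma (β + ρ * n) := Real.Gamma_pos_of_pos (by positivity)
  positivity

lemma ac_nonneg (ρ β : ℝ) (hρ : 0 < ρ) (hβ : 0 < β) (k n : ℕ) : 0 ≤ ac ρ β k n := by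
  unfold ac
  have h1 : 0 ≤ ∏ i ∈ Finset.range (k + 1), (β + ρ * n + i) := Finset.prod_nonneg fun i _ => by positivity
  have h2 : 0 ≤ ∏ i ∈ Finset.range (k + 1), (β + i) := Finset.prod_nonneg fun i _ => by positivity
  positivity

lemma ac_bound (ρ β : ℝ) (hρ : 0 < ρ) (hβ : 0 < β) (k n : ℕ) (hk : 1 ≤ k) :
    ac ρ β k n ≤ (Real.exp (ρ * (1 / β + 1))) ^ n / n.factorial := by
  have hk0 : (0 : ℝ) < k := by exact_mod_cast hk
  have hprod : (∏ i ∈ Finset.range (k + 1), (β + ρ * n + i)) /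
    (∏ i ∈ Finset.range (k + 1), (β + i)) ≤ Real.exp (ρ * n * (1 / β + 1 + Real.log k)) := by
    rw [← Finset.prod_div_distrib]
    have h1 : ∑ i ∈ Finset.range (k + 1), 1 / (β + i) ≤ 1 / β + 1 + Real.log k := by
      rw [Finset.sum_range_succ']
      have h2 : ∑ i ∈ Finset.range k, 1 / (β + ((i + 1 : ℕ) : ℝ)) ≤ (harmonic k : ℝ) := by
        unfold harmonic
        push_cast
        apply Finset.sum_le_sum
        intro i _
        rw [one_div]
        apply inv_anti₀ (by positivity)
        linarith
      have h3 := harmonic_le_one_add_log k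
      simp only [Nat.cast_zero, add_zero]
      linarith
    calc _ ≤ ∏ i ∈ Finset.range (k + 1), Real.exp (ρ * n * (1 / (β + i))) := by
          apply Finset.prod_le_prod
          · intro i _; positivity
          · intro i _
            have : (β + ρ * n + i) / (β + i) = ρ * n * (1 / (β + i)) + 1 := by
              field_simp; ring
            rw [this]
            exact Real.add_one_le_exp _
      _ = Real.exp (ρ * n * ∑ i ∈ Finset.range (k + 1), 1 / (β + i)) := by
          rw [← Real.exp_sum, Finset.mul_sum]
      _ ≤ _ := by
          apply Real.exp_le_exp.2
          apply mul_le_mul_of_nonneg_left h1; positivity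
  have hch : (k.choose n : ℝ) ≤ (k : ℝ) ^ n / n.factorial := Nat.choose_le_pow_div n k
  have he : Real.exp (ρ * n * (1 / β + 1 + Real.log k)) =
      (Real.exp (ρ * (1 / β + 1))) ^ n * ((k : ℝ) ^ ρ) ^ n := by
    rw [Real.rpow_def_of_pos hk0, ← Real.exp_nat_mul, ← Real.exp_nat_mul, ← Real.exp_add]
    congr 1; ring
  have hkr : (0 : ℝ) < (k : ℝ) ^ ρ := Real.rpow_pos_of_pos hk0 ρ
  unfold ac
  rw [mul_div_assoc]
  have h0 : 0 ≤ (∏ i ∈ Finset.range (k + 1), (β + ρ * n + i)) /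
    (∏ i ∈ Finset.range (k + 1), (β + i)) := by
    apply div_nonneg <;> exact Finset.prod_nonneg fun i _ => by positivity
  calc _ ≤ (k : ℝ) ^ n / n.factorial * ((Real.exp (ρ * (1 / β + 1))) ^ n * ((k : ℝ) ^ ρ) ^ n) *
        (1 / (k * (k : ℝ) ^ ρ)) ^ n := by
        rw [← he]; gcongr
    _ = _ := by
        generalize Real.exp (ρ * (1 / β + 1)) = E
        rw [div_pow, one_pow, mul_pow]
        field_simp

lemma ac_tendsto (ρ β : ℝ) (hρ : 0 < ρ) (hβ : 0 < β) (n : ℕ) :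
    Tendsto (fun k => ac ρ β k n) atTop (𝓝 (wc ρ β n)) := by
  have h1 := Real.GammaSeq_tendsto_Gamma β
  have h2 := Real.GammaSeq_tendsto_Gamma (β + ρ * n)
  have hG : Real.Gamma (β + ρ * n) ≠ 0 := (Real.Gamma_pos_of_pos (by positivity)).ne'
  have h3 : Tendsto (fun k : ℕ => (k.choose n : ℝ) / (k : ℝ) ^ n) atTop (𝓝 (1 / n.factorial)) := by
    have := isEquivalent_choose n
    have h4 := (Asymptotics.isEquivalent_iff_tendsto_one (by
      filter_upwards [eventually_ge_atTop 1] with k hk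
      have : (0 : ℝ) < k := by exact_mod_cast hk
      positivity)).1 this
    have h5 := h4.div_const (n.factorial : ℝ)
    refine h5.congr' ?_
    filter_upwards [eventually_ge_atTop 1] with k hk
    have : (0 : ℝ) < k := by exact_mod_cast hk
    simp only [Pi.div_apply]
    field_simp
  have h4 := h3.mul (h1.div h2 hG)
  have h5 : 1 / (n.factorial : ℝ) * (Real.Gamma β / Real.Gamma (β + ρ * n)) = wc ρ β n := by
    unfold wc; field_simp
  rw [h5] at h4
  refine h4.congr' ?_
  filter_upwards [eventually_ge_atTop 1] with k hk
  have hk0 : (0 : ℝ) < k := by exact_mod_cast hk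
  simp only [Pi.div_apply]
  unfold ac Real.GammaSeq
  have hA : (∏ i ∈ Finset.range (k + 1), (β + ρ * n + i)) ≠ 0 := 
    (Finset.prod_pos fun i _ => by positivity).ne'
  have hB : (∏ i ∈ Finset.range (k + 1), (β + (i : ℝ))) ≠ 0 := 
    (Finset.prod_pos fun i _ => by positivity).ne'
  have hkr : (0 : ℝ) < (k : ℝ) ^ ρ := Real.rpow_pos_of_pos hk0 ρ
  have hkb : (0 : ℝ) < (k : ℝ) ^ β := Real.rpow_pos_of_pos hk0 β
  rw [Real.rpow_add hk0, Real.rpow_mul_natCast hk0.le, one_div, inv_pow, mul_pow]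
  field_simp

lemma wc_bound (ρ β : ℝ) (hρ : 0 < ρ) (hβ : 0 < β) (n : ℕ) :
    wc ρ β n ≤ (Real.exp (ρ * (1 / β + 1))) ^ n / n.factorial := 
  le_of_tendsto (ac_tendsto ρ β hρ hβ n) (by
    filter_upwards [eventually_ge_atTop 1] with k hk using ac_bound ρ β hρ hβ k n hk)

lemma wc_summable (ρ β : ℝ) (hρ : 0 < ρ) (hβ : 0 < β) (x : ℝ) (hx : 0 ≤ x) :
    Summable fun n => wc ρ β n * x ^ n := by
  refine Summable.of_nonneg_of_le (fun n => ?_) (fun n => ?_)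
    (Real.summable_pow_div_factorial (Real.exp (ρ * (1 / β + 1)) * x))
  · have := wc_pos ρ β hρ hβ n; positivity
  · rw [mul_pow, mul_div_right_comm]
    exact mul_le_mul_of_nonneg_right (wc_bound ρ β hρ hβ n) (by positivity)

lemma norm_term (ρ β : ℝ) (hρ : 0 < ρ) (hβ : 0 < β) (z : ℂ) (n : ℕ) :
    ‖(wc ρ β n : ℂ) * z ^ n‖ = wc ρ β n * ‖z‖ ^ n := by
  rw [norm_mul, norm_pow, Complex.norm_real, Real.norm_of_nonneg (wc_pos ρ β hρ hβ n).le]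

lemma FF_summable (ρ β : ℝ) (hρ : 0 < ρ) (hβ : 0 < β) (z : ℂ) :
    Summable fun n => (wc ρ β n : ℂ) * z ^ n := by
  apply Summable.of_norm
  simp_rw [norm_term ρ β hρ hβ]
  exact wc_summable ρ β hρ hβ _ (norm_nonneg z)

lemma lam_eq (ρ β : ℝ) (z : ℂ) : lam ρ β z = FF ρ β (-z ^ 2) := by
  unfold lam wright FF
  rw [← tsum_mul_left]
  refine tsum_congr fun n => ?_
  unfold wc
  rw [add_comm β, Complex.Gamma_ofReal, Complex.Gamma_ofReal]
  push_cast
  rw [mul_div_assoc', div_mul_eq_mul_div]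

/-- polynomial approximation -/
lemma FF_approx (ρ β : ℝ) (hρ : 0 < ρ) (hβ : 0 < β) :
    ∃ (u : ℕ → ℕ → ℝ) (d : ℕ → ℕ), (∀ k, Antitone (u k)) ∧ (∀ k j, 0 ≤ u k j) ∧
      (∀ k j, d k ≤ j → u k j = 0) ∧
      ∀ z : ℂ, Tendsto (fun k => ∏ j ∈ Finset.range (d k), (1 + z * u k j)) atTop (𝓝 (FF ρ β z)) := by
  have key : ∀ k : ℕ, ∃ (u : ℕ → ℝ) (d : ℕ), Antitone u ∧ (∀ j, 0 ≤ u j) ∧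
      (∀ j, d ≤ j → u j = 0) ∧ ∀ z : ℂ, ∏ j ∈ Finset.range d, (1 + z * u j) =
        ∑' n : ℕ, (ac ρ β (k + 1) n : ℂ) * z ^ n := by
    intro k
    obtain ⟨p, hp, hr⟩ := exists_poly ρ β hρ hβ (k + 1) (k + 1 + 1)
    obtain ⟨u, d, h1, h2, h3, h4⟩ := poly_factor p hr
    have hk0 : (0 : ℝ) < ((k + 1 : ℕ) : ℝ) := by positivity
    set q : ℝ := 1 / (((k + 1 : ℕ) : ℝ) * ((k + 1 : ℕ) : ℝ) ^ ρ) with hq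
    have hq0 : 0 ≤ q := by positivity
    have hB : (∏ i ∈ Finset.range (k + 1 + 1), (β + (i : ℝ))) ≠ 0 := 
      (Finset.prod_pos fun i _ => by positivity).ne'
    have hp0 : p.eval 0 = ((∏ i ∈ Finset.range (k + 1 + 1), (β + (i : ℝ)) : ℝ) : ℂ) := by
      rw [← coeff_zero_eq_eval_zero, hp]; simp
    refine ⟨fun j => q * u j, d, fun i j hij => mul_le_mul_of_nonneg_left (h1 hij) hq0,
      fun j => mul_nonneg hq0 (h2 j), fun j hj => by simp [h3 j hj], fun z => ?_⟩
    have h5 := h4 (z * q)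
    have h6 : ∏ j ∈ Finset.range d, (1 + z * ((q * u j : ℝ) : ℂ)) = p.eval (z * q) / p.eval 0 := by
      rw [h5, mul_div_cancel_left₀]
      · refine Finset.prod_congr rfl fun j _ => ?_
        push_cast; ring
      · rw [hp0]; exact_mod_cast hB
    rw [h6]
    have hdeg : p.natDegree < k + 2 := by
      rw [Nat.lt_succ_iff, natDegree_le_iff_coeff_eq_zero]
      intro N hN
      rw [hp, Nat.choose_eq_zero_of_lt hN]; simp
    rw [eval_eq_sum_range' hdeg, tsum_eq_sum (s := Finset.range (k + 2)), Finset.sum_div]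
    · refine Finset.sum_congr rfl fun n _ => ?_
      rw [hp, hp0]
      unfold ac
      rw [← hq]
      push_cast
      ring
    · intro n hn
      have : k + 1 < n := by simp at hn; omega
      unfold ac
      rw [Nat.choose_eq_zero_of_lt this]; simp
  choose u d h1 h2 h3 h4 using key
  refine ⟨u, d, h1, h2, h3, fun z => ?_⟩
  simp_rw [h4]
  unfold FF
  apply tendsto_tsum_of_dominated_convergence
    (Real.summable_pow_div_factorial (Real.exp (ρ * (1 / β + 1)) * ‖z‖))
  · intro n
    apply Tendsto.mul_const
    exact (Complex.continuous_ofReal.tendsto _).comp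
      ((ac_tendsto ρ β hρ hβ n).comp (tendsto_add_atTop_nat 1))
  · refine Eventually.of_forall fun k n => ?_
    rw [norm_mul, norm_pow, Complex.norm_real, Real.norm_of_nonneg (ac_nonneg ρ β hρ hβ _ n),
      mul_pow, mul_div_right_comm]
    exact mul_le_mul_of_nonneg_right (ac_bound ρ β hρ hβ _ n (by omega)) (by positivity)

lemma gamma_growth (β B : ℝ) (hβ : 0 < β) (hB : 0 < B) :
    ∃ C, ∀ s, β ≤ s → B ^ s / Real.Gamma s ≤ C := by
  set T := max β B with hT
  have hcont : ContinuousOn (fun s : ℝ => B ^ s / Real.Gamma s) (Icc β (T + 1)) := by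
    intro s hs
    have hs0 : 0 < s := hβ.trans_le hs.1
    apply ContinuousAt.continuousWithinAt
    apply ContinuousAt.div
    · exact (Real.continuous_const_rpow hB.ne').continuousAt
    · apply (Real.differentiableAt_Gamma _).continuousAt
      intro m hm
      have : (0 : ℝ) ≤ m := by positivity
      linarith
    · exact (Real.Gamma_pos_of_pos hs0).ne'
  obtain ⟨C, hC⟩ := isCompact_Icc.bddAbove_image hcont
  have key : ∀ m : ℕ, ∀ s, β ≤ s → s ≤ T + 1 + m → B ^ s / Real.Gamma s ≤ C := by
    intro m
    induction m with
    | zero => intro s h1 h2; exact hC ⟨s, ⟨h1, by simpa using h2⟩, rfl⟩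
    | succ m ih =>
      intro s h1 h2
      by_cases h3 : s ≤ T + 1 + m
      · exact ih s h1 h3
      · push Not at h3
        have hm : (0 : ℝ) ≤ m := by positivity
        have hTB : B ≤ T := le_max_right _ _
        have hTb : β ≤ T := le_max_left _ _
        push_cast at h2
        have h4 := ih (s - 1) (by linarith) (by linarith)
        have hs1 : 0 < s - 1 := by linarith
        have hG := Real.Gamma_pos_of_pos hs1
        have h5 : Real.Gamma s = (s - 1) * Real.Gamma (s - 1) := by
          have := Real.Gamma_add_one hs1.ne'
          rwa [sub_add_cancel] at this
        have h6 : B ^ s = B ^ (s - 1) * B := by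
          have := Real.rpow_add_one hB.ne' (s - 1)
          rwa [sub_add_cancel] at this
        refine le_trans ?_ h4
        rw [h5, h6, mul_comm (s - 1), mul_div_mul_comm]
        have hp : 0 < B ^ (s - 1) := Real.rpow_pos_of_pos hB _
        apply mul_le_of_le_one_right (by positivity)
        rw [div_le_one hs1]; linarith
  refine ⟨C, fun s hs => ?_⟩
  obtain ⟨m, hm⟩ := exists_nat_ge s
  have : 0 ≤ T := hβ.le.trans (le_max_left _ _)
  exact key m s hs (by linarith)

lemma wc_small (ρ β : ℝ) (hρ : 0 < ρ) (hβ : 0 < β) (ε : ℝ) (hε : 0 < ε) :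
    ∃ C, ∀ n, wc ρ β n ≤ C * (ε ^ n / n.factorial) := by
  set B : ℝ := (1 / ε) ^ (1 / ρ) with hB
  have hB0 : 0 < B := by positivity
  obtain ⟨C, hC⟩ := gamma_growth β B hβ hB0
  refine ⟨Real.Gamma β * C / B ^ β, fun n => ?_⟩
  have h1 := hC (β + ρ * n) (by have : 0 ≤ ρ * n := by positivity
                                linarith)
  have hG : 0 < Real.Gamma (β + ρ * n) := Real.Gamma_pos_of_pos (by positivity)
  have hGb := Real.Gamma_pos_of_pos hβ
  have h2 : B ^ (β + ρ * n) = B ^ β * (1 / ε) ^ n := by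
    have h3 : B ^ ρ = 1 / ε := by
      rw [hB, ← Real.rpow_mul (by positivity), one_div_mul_cancel hρ.ne', Real.rpow_one]
    rw [Real.rpow_add hB0, Real.rpow_mul_natCast hB0.le, h3]
  have hBb : 0 < B ^ β := Real.rpow_pos_of_pos hB0 _
  rw [h2, div_pow, one_pow] at h1
  have h3 : 1 / Real.Gamma (β + ρ * n) ≤ C * ε ^ n / B ^ β := by
    rw [le_div_iff₀ hBb]
    have := mul_le_mul_of_nonneg_right h1 (pow_pos hε n).le
    refine le_trans (le_of_eq ?_) this
    field_simp
  unfold wc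
  calc _ = Real.Gamma β / n.factorial * (1 / Real.Gamma (β + ρ * n)) := by field_simp
    _ ≤ Real.Gamma β / n.factorial * (C * ε ^ n / B ^ β) := by gcongr
    _ = _ := by field_simp

lemma FF_real (ρ β : ℝ) (x : ℝ) : FF ρ β x = ((∑' n, wc ρ β n * x ^ n : ℝ) : ℂ) := by
  unfold FF
  rw [Complex.ofReal_tsum]
  push_cast
  rfl

lemma FF_norm (ρ β : ℝ) (hρ : 0 < ρ) (hβ : 0 < β) (x : ℝ) (hx : 0 ≤ x) :
    ‖FF ρ β x‖ = ∑' n, wc ρ β n * x ^ n := by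
  rw [FF_real, Complex.norm_real, Real.norm_of_nonneg]
  exact tsum_nonneg fun n => mul_nonneg (wc_pos ρ β hρ hβ n).le (by positivity)

lemma FF_growth (ρ β : ℝ) (hρ : 0 < ρ) (hβ : 0 < β) (ε : ℝ) (hε : 0 < ε) :
    ∃ C, ∀ x : ℝ, 0 ≤ x → ‖FF ρ β x‖ ≤ C * Real.exp (ε * x) := by
  obtain ⟨C, hC⟩ := wc_small ρ β hρ hβ ε hε
  refine ⟨C, fun x hx => ?_⟩
  rw [FF_norm ρ β hρ hβ x hx, Real.exp_eq_exp_ℝ, NormedSpace.exp_eq_tsum_div, ← tsum_mul_left]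
  refine Summable.tsum_le_tsum (fun n => ?_) (wc_summable ρ β hρ hβ x hx)
    ((Real.summable_pow_div_factorial _).mul_left _)
  calc _ ≤ C * (ε ^ n / n.factorial) * x ^ n := mul_le_mul_of_nonneg_right (hC n) (by positivity)
    _ = _ := by rw [mul_pow]; ring

lemma mult_aux (v : ℕ → ℝ) (hv0 : ∀ j, 0 ≤ v j) (hvS : Summable v) (z : ℂ) :
    Summable fun j => ‖z * (v j : ℂ)‖ := by
  simp_rw [norm_mul, Complex.norm_real, Real.norm_of_nonneg (hv0 _)]
  exact hvS.mul_left _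

lemma one_le_norm_tprod (v : ℕ → ℝ) (hv0 : ∀ j, 0 ≤ v j) (hvS : Summable v) (x : ℝ) (hx : 0 ≤ x) :
    1 ≤ ‖∏' j, (1 + (x : ℂ) * v j)‖ := by
  have h1 := (multipliable_one_add_of_summable (mult_aux v hv0 hvS x)).hasProd.tendsto_prod_nat
  refine ge_of_tendsto' h1.norm fun n => ?_
  rw [norm_prod]
  have h0 : ∏ j ∈ Finset.range n, (1 : ℝ) ≤ ∏ j ∈ Finset.range n, ‖1 + (x : ℂ) * v j‖ := by
    refine Finset.prod_le_prod (fun _ _ => zero_le_one) fun j _ => ?_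
    have : (1 + (x : ℂ) * v j) = ((1 + x * v j : ℝ) : ℂ) := by push_cast; rfl
    have h2 := mul_nonneg hx (hv0 j)
    rw [this, Complex.norm_real, Real.norm_of_nonneg (by linarith)]
    linarith
  simpa using h0

lemma FF_prod (ρ β : ℝ) (hρ : 0 < ρ) (hβ : 0 < β) :
    ∃ v : ℕ → ℝ, Antitone v ∧ (∀ j, 0 < v j) ∧ Summable v ∧
      ∀ z, FF ρ β z = ∏' j, (1 + z * v j) := by
  obtain ⟨u, d, h1, h2, h3, h4⟩ := FF_approx ρ β hρ hβ
  obtain ⟨v, c, hva, hv0, hc0, hvS, hF⟩ := lp_limit u d h1 h2 h3 _ h4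
  have hc : c = 0 := by
    by_contra hne
    have hc : 0 < c := lt_of_le_of_ne hc0 (Ne.symm hne)
    obtain ⟨C, hC⟩ := FF_growth ρ β hρ hβ (c / 2) (by positivity)
    have key : ∀ x : ℝ, 0 ≤ x → c / 2 * x + 1 ≤ C := by
      intro x hx
      have h5 := hC x hx
      rw [hF, norm_mul] at h5
      have h6 := one_le_norm_tprod v hv0 hvS x hx
      have h7 : ‖cexp ((c : ℂ) * (x : ℂ))‖ = Real.exp (c / 2 * x) * Real.exp (c / 2 * x) := by
        rw [← Complex.ofReal_mul, Complex.norm_exp_ofReal, ← Real.exp_add]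
        congr 1; ring
      rw [h7] at h5
      have h8 := Real.exp_pos (c / 2 * x)
      have h9 : Real.exp (c / 2 * x) ≤ C := by
        by_contra hlt
        push Not at hlt
        have : C * Real.exp (c / 2 * x) < Real.exp (c / 2 * x) * Real.exp (c / 2 * x) := by gcongr
        have h10 : Real.exp (c / 2 * x) * Real.exp (c / 2 * x) * 1 ≤ Real.exp (c / 2 * x) * Real.exp (c / 2 * x) * ‖∏' j, (1 + (x : ℂ) * v j)‖ := by gcongr
        linarith
      exact (Real.add_one_le_exp _).trans h9
    have h0 := key 0 le_rfl
    have := key (2 * C / c) (by apply div_nonneg _ hc.le; linarith)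
    have h11 : c / 2 * (2 * C / c) = C := by field_simp
    linarith
  subst hc
  have hF' : ∀ z, FF ρ β z = ∏' j, (1 + z * v j) := by
    intro z; rw [hF z]; simp
  refine ⟨v, hva, fun N => ?_, hvS, hF'⟩
  by_contra hN
  have hN0 : v N = 0 := le_antisymm (not_lt.1 hN) (hv0 N)
  have hw := wc_pos ρ β hρ hβ (N + 1)
  have key : ∀ x : ℝ, 1 ≤ x → wc ρ β (N + 1) * x ≤ (1 + v 0) ^ N := by
    intro x hx
    have hx0 : 0 ≤ x := by linarith
    have h5 : wc ρ β (N + 1) * x ^ (N + 1) ≤ ‖FF ρ β x‖ := by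
      rw [FF_norm ρ β hρ hβ x hx0]
      exact (wc_summable ρ β hρ hβ x hx0).le_tsum (N + 1) fun n _ =>
        mul_nonneg (wc_pos ρ β hρ hβ n).le (by positivity)
    have h6 : ‖FF ρ β x‖ ≤ (x * (1 + v 0)) ^ N := by
      rw [hF', tprod_eq_prod (s := Finset.range N), norm_prod]
      · calc _ ≤ ∏ j ∈ Finset.range N, (x * (1 + v 0)) := by
              refine Finset.prod_le_prod (fun j _ => norm_nonneg _) fun j _ => ?_
              refine (norm_add_le _ _).trans ?_
              rw [norm_one, norm_mul, Complex.norm_real, Complex.norm_real,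
                Real.norm_of_nonneg hx0, Real.norm_of_nonneg (hv0 j)]
              have := mul_le_mul_of_nonneg_left (hva (Nat.zero_le j)) hx0
              linarith
          _ = _ := by simp
      · intro j hj
        have : v j = 0 := le_antisymm ((hva (by simpa using hj)).trans hN0.le) (hv0 j)
        simp [this]
    have h7 := h5.trans h6
    rw [mul_pow, pow_succ, ← mul_assoc, mul_comm _ (x ^ N), mul_assoc] at h7
    have hxN : 0 < x ^ N := by positivity
    have := le_of_mul_le_mul_left (by linarith : x ^ N * (wc ρ β (N + 1) * x) ≤ x ^ N * (1 + v 0) ^ N) hxN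
    exact this
  have hpos : 0 ≤ (1 + v 0) ^ N := by have := hv0 0; positivity
  have h8 := key ((1 + v 0) ^ N / wc ρ β (N + 1) + 1) (by
    have : 0 ≤ (1 + v 0) ^ N / wc ρ β (N + 1) := by positivity
    linarith)
  rw [mul_add, mul_div_cancel₀ _ hw.ne'] at h8
  linarith

lemma wc_rec (ρ β : ℝ) (hρ : 0 < ρ) (hβ : 0 < β) (n : ℕ) :
    wc ρ β n = wc ρ (β + 1) n * (1 + ρ * n / β) := by
  unfold wc
  have h0 : 0 < β + ρ * n := by positivity
  have h1 := Real.Gamma_add_one hβ.ne'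
  have h2 := Real.Gamma_add_one h0.ne'
  have hG := Real.Gamma_pos_of_pos h0
  have h3 : β + 1 + ρ * n = β + ρ * n + 1 := by ring
  rw [h3, h1, h2]
  field_simp

lemma FF_diff (ρ β : ℝ) (hρ : 0 < ρ) (hβ : 0 < β) : Differentiable ℂ (FF ρ β) := by
  intro z
  have h : DifferentiableOn ℂ (FF ρ β) (Metric.ball 0 (‖z‖ + 1)) := by
    refine differentiableOn_tsum_of_summable_norm
      (wc_summable ρ β hρ hβ (‖z‖ + 1) (by positivity)) (fun n => by fun_prop) Metric.isOpen_ball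
      (fun n w hw => ?_)
    rw [norm_term ρ β hρ hβ]
    have hw' : ‖w‖ < ‖z‖ + 1 := by simpa using hw
    have := (wc_pos ρ β hρ hβ n).le
    gcongr
  exact h.differentiableAt (Metric.isOpen_ball.mem_nhds (by simp))

lemma FF_rec (ρ β : ℝ) (hρ : 0 < ρ) (hβ : 0 < β) (z : ℂ) :
    FF ρ β z = FF ρ (β + 1) z + ((ρ / β : ℝ) : ℂ) * (z * deriv (FF ρ (β + 1)) z) := by
  have hβ1 : 0 < β + 1 := by linarith
  have h : HasSum (fun n : ℕ => deriv (fun w : ℂ => (wc ρ (β + 1) n : ℂ) * w ^ n) z)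
      (deriv (FF ρ (β + 1)) z) := by
    refine hasSum_deriv_of_summable_norm (U := Metric.ball 0 (‖z‖ + 1))
      (wc_summable ρ (β + 1) hρ hβ1 (‖z‖ + 1) (by positivity)) (fun n => by fun_prop)
      Metric.isOpen_ball (fun n w hw => ?_) (by simp)
    rw [norm_term ρ (β + 1) hρ hβ1]
    have hw' : ‖w‖ < ‖z‖ + 1 := by simpa using hw
    have := (wc_pos ρ (β + 1) hρ hβ1 n).le
    gcongr
  have h2 := (FF_summable ρ (β + 1) hρ hβ1 z).hasSum.add ((h.mul_left z).mul_left ((ρ / β : ℝ) : ℂ))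
  refine HasSum.tsum_eq ?_
  change HasSum _ (∑' b : ℕ, (wc ρ (β + 1) b : ℂ) * z ^ b + _)
  convert h2 using 1
  funext n
  have h3 : deriv (fun w : ℂ => (wc ρ (β + 1) n : ℂ) * w ^ n) z =
      (wc ρ (β + 1) n : ℂ) * (n * z ^ (n - 1)) := by
    simp
  rw [h3, wc_rec ρ β hρ hβ n]
  have h4 : z * (n * z ^ (n - 1)) = n * z ^ n := by
    cases n with
    | zero => simp
    | succ n => simp only [Nat.add_sub_cancel]; rw [pow_succ]; ring
  push_cast
  linear_combination (-(ρ / β : ℂ) * (wc ρ (β + 1) n : ℂ)) * h4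

/-- partial products -/
noncomputable def QQ (v : ℕ → ℝ) (N : ℕ) (z : ℂ) : ℂ := ∏ j ∈ Finset.range N, (1 + z * v j)

lemma QQ_diff (v : ℕ → ℝ) (N : ℕ) : Differentiable ℂ (QQ v N) := by
  unfold QQ
  fun_prop

lemma QQ_lim (v : ℕ → ℝ) (hv0 : ∀ j, 0 ≤ v j) (hvS : Summable v) (G : ℂ → ℂ)
    (hG : ∀ z, G z = ∏' j, (1 + z * v j)) (z : ℂ) :
    Tendsto (fun N => QQ v N z) atTop (𝓝 (G z)) ∧
    Tendsto (fun N => deriv (QQ v N) z) atTop (𝓝 (deriv G z)) ∧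
    Tendsto (fun N => deriv (deriv (QQ v N)) z) atTop (𝓝 (deriv (deriv G) z)) := by
  set U := Metric.ball (0 : ℂ) (‖z‖ + 1) with hU
  have hUo : IsOpen U := Metric.isOpen_ball
  have hzU : z ∈ U := by simp [hU]
  have h1 : HasProdLocallyUniformlyOn (fun (n : ℕ) (x : ℂ) => 1 + x * (v n : ℂ))
      (fun x => ∏' i, (1 + x * (v i : ℂ))) U := by
    refine Summable.hasProdLocallyUniformlyOn_nat_one_add hUo (hvS.mul_left (‖z‖ + 1))
      (Eventually.of_forall fun n x hx => ?_) (fun n => by fun_prop)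
    have hw' : ‖x‖ < ‖z‖ + 1 := by simpa [hU] using hx
    rw [norm_mul, Complex.norm_real, Real.norm_of_nonneg (hv0 n)]
    have := hv0 n
    gcongr
  have h2 : TendstoLocallyUniformlyOn (fun N => QQ v N) G atTop U := by
    have h3 := h1.tendstoLocallyUniformlyOn_finsetRange
    have h4 : G = fun x => ∏' i, (1 + x * (v i : ℂ)) := funext hG
    rw [h4]
    exact h3
  have h3 := h2.deriv (Eventually.of_forall fun N => (QQ_diff v N).differentiableOn) hUo
  have h4 := h3.deriv (Eventually.of_forall fun N =>
    ((QQ_diff v N).differentiableOn (s := U)).deriv hUo) hUo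
  exact ⟨h2.tendsto_at hzU, h3.tendsto_at hzU, h4.tendsto_at hzU⟩

lemma QQ_succ_deriv (v : ℕ → ℝ) (N : ℕ) (z : ℂ) :
    deriv (QQ v (N + 1)) z = deriv (QQ v N) z * (1 + z * v N) + QQ v N z * v N := by
  have : QQ v (N + 1) = fun z => QQ v N z * (1 + z * v N) := by
    funext w; unfold QQ; rw [Finset.prod_range_succ]
  rw [this]
  have h1 : HasDerivAt (fun z : ℂ => 1 + z * (v N : ℂ)) (v N : ℂ) z := by
    simpa using ((hasDerivAt_id z).mul_const (v N : ℂ)).const_add 1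
  exact ((QQ_diff v N z).hasDerivAt.mul h1).deriv

lemma QQ_succ_deriv2 (v : ℕ → ℝ) (N : ℕ) (z : ℂ) :
    deriv (deriv (QQ v (N + 1))) z =
      deriv (deriv (QQ v N)) z * (1 + z * v N) + 2 * deriv (QQ v N) z * v N := by
  have : deriv (QQ v (N + 1)) = fun z => deriv (QQ v N) z * (1 + z * v N) + QQ v N z * v N :=
    funext (QQ_succ_deriv v N)
  rw [this]
  have h1 : HasDerivAt (fun z : ℂ => 1 + z * (v N : ℂ)) (v N : ℂ) z := by
    simpa using ((hasDerivAt_id z).mul_const (v N : ℂ)).const_add 1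
  have h2 : HasDerivAt (deriv (QQ v N)) (deriv (deriv (QQ v N)) z) z :=
    ((QQ_diff v N).deriv z).hasDerivAt
  refine (((h2.mul h1).add ((QQ_diff v N z).hasDerivAt.mul_const (v N : ℂ))).deriv).trans ?_
  ring

lemma QQ_laguerre (v : ℕ → ℝ) (hv0 : ∀ j, 0 ≤ v j) (x : ℝ) (N : ℕ) :
    ∃ a b c : ℝ, QQ v (N + 1) x = a ∧ deriv (QQ v (N + 1)) x = b ∧
      deriv (deriv (QQ v (N + 1))) x = c ∧
      v 0 * a ^ 2 ≤ (1 + x * v 0) ^ 2 * ((b + x * c) * a - x * b ^ 2) := by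
  have hQ0 : QQ v 0 = fun _ => 1 := by funext z; simp [QQ]
  induction N with
  | zero =>
    refine ⟨1 + x * v 0, v 0, 0, ?_, ?_, ?_, ?_⟩
    · simp [QQ]
    · rw [QQ_succ_deriv]; simp [hQ0]
    · rw [QQ_succ_deriv2]; simp [hQ0]
    · apply le_of_eq; ring
  | succ N ih =>
    obtain ⟨a, b, c, ha, hb, hc, h⟩ := ih
    refine ⟨a * (1 + x * v (N + 1)), b * (1 + x * v (N + 1)) + a * v (N + 1),
      c * (1 + x * v (N + 1)) + 2 * b * v (N + 1), ?_, ?_, ?_, ?_⟩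
    · have : QQ v (N + 1 + 1) x = QQ v (N + 1) x * (1 + x * v (N + 1)) := by
        unfold QQ; rw [Finset.prod_range_succ]
      rw [this, ha]; push_cast; rfl
    · rw [QQ_succ_deriv, ha, hb]; push_cast; rfl
    · rw [QQ_succ_deriv2, hb, hc]; push_cast; rfl
    · set w := v (N + 1) with hw
      have h1 : 0 ≤ (1 + x * v 0) ^ 2 * (w * a ^ 2) := by
        have : 0 ≤ w := hv0 _
        positivity
      have h2 := mul_le_mul_of_nonneg_left h (sq_nonneg (1 + x * w))
      have h3 : (1 + x * v 0) ^ 2 * (((b * (1 + x * w) + a * w) + x * (c * (1 + x * w) + 2 * b * w)) *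
          (a * (1 + x * w)) - x * (b * (1 + x * w) + a * w) ^ 2) =
          (1 + x * w) ^ 2 * ((1 + x * v 0) ^ 2 * ((b + x * c) * a - x * b ^ 2)) +
          (1 + x * v 0) ^ 2 * (w * a ^ 2) := by ring
      rw [h3]
      nlinarith

lemma laguerre (v : ℕ → ℝ) (hv0 : ∀ j, 0 ≤ v j) (hvS : Summable v) (G : ℂ → ℂ)
    (hG : ∀ z, G z = ∏' j, (1 + z * v j)) (x : ℝ) :
    ∃ a b c : ℝ, G x = a ∧ deriv G x = b ∧ deriv (deriv G) x = c ∧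
      v 0 * a ^ 2 ≤ (1 + x * v 0) ^ 2 * ((b + x * c) * a - x * b ^ 2) := by
  obtain ⟨h1, h2, h3⟩ := QQ_lim v hv0 hvS G hG x
  choose a b c ha hb hc h using QQ_laguerre v hv0 x
  have h1' := h1.comp (tendsto_add_atTop_nat 1)
  have h2' := h2.comp (tendsto_add_atTop_nat 1)
  have h3' := h3.comp (tendsto_add_atTop_nat 1)
  simp only [Function.comp_def, ha, hb, hc] at h1' h2' h3'
  have aux : ∀ (s : ℕ → ℝ) (L : ℂ), Tendsto (fun n => (s n : ℂ)) atTop (𝓝 L) →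
      L = (L.re : ℂ) ∧ Tendsto s atTop (𝓝 L.re) := by
    intro s L hs
    have hre : Tendsto s atTop (𝓝 L.re) := by
      simpa [Function.comp_def] using (Complex.continuous_re.tendsto L).comp hs
    exact ⟨tendsto_nhds_unique hs ((Complex.continuous_ofReal.tendsto _).comp hre), hre⟩
  obtain ⟨e1, t1⟩ := aux a _ h1'
  obtain ⟨e2, t2⟩ := aux b _ h2'
  obtain ⟨e3, t3⟩ := aux c _ h3'
  refine ⟨_, _, _, e1, e2, e3, ?_⟩
  exact le_of_tendsto_of_tendsto' ((t1.pow 2).const_mul _)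
    ((((t2.add (t3.const_mul x)).mul t1).sub ((t2.pow 2).const_mul x)).const_mul _) h

lemma double_step (ρ β : ℝ) (hρ : 0 < ρ) (hβ : 0 < β) (x : ℝ) (hx : x ≠ 0)
    (h0 : FF ρ β x = 0) (h1 : deriv (FF ρ β) x = 0) :
    FF ρ (β + 1) x = 0 ∧ deriv (FF ρ (β + 1)) x = 0 := by
  have hβ1 : 0 < β + 1 := by linarith
  obtain ⟨v, -, hv, hvS, hG⟩ := FF_prod ρ (β + 1) hρ hβ1
  obtain ⟨a, b, c, ha, hb, hc, h⟩ := laguerre v (fun j => (hv j).le) hvS _ hG x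
  set r : ℝ := ρ / β with hr
  have hr0 : 0 < r := by positivity
  have hrec : FF ρ β = fun z => FF ρ (β + 1) z + (r : ℂ) * (z * deriv (FF ρ (β + 1)) z) :=
    funext (FF_rec ρ β hρ hβ)
  have hd := FF_diff ρ (β + 1) hρ hβ1
  have hd2 : HasDerivAt (fun z => FF ρ (β + 1) z + (r : ℂ) * (z * deriv (FF ρ (β + 1)) z))
      (deriv (FF ρ (β + 1)) x + (r : ℂ) * (1 * deriv (FF ρ (β + 1)) x +
        x * deriv (deriv (FF ρ (β + 1))) x)) x :=
    (hd x).hasDerivAt.add (((hasDerivAt_id (x : ℂ)).mul (hd.deriv x).hasDerivAt).const_mul (r : ℂ))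
  rw [hrec] at h0 h1
  rw [hd2.deriv] at h1
  simp only [ha, hb, hc] at h0 h1
  have e0 : a + r * (x * b) = 0 := by exact_mod_cast h0
  have e1 : b + r * (1 * b + x * c) = 0 := by exact_mod_cast h1
  have e2 : (b + x * c) * a - x * b ^ 2 = 0 := by
    have : r * ((b + x * c) * a - x * b ^ 2) = 0 := by linear_combination a * e1 - b * e0
    exact (mul_eq_zero.1 this).resolve_left hr0.ne'
  rw [e2, mul_zero] at h
  have ha0 : a = 0 := by
    by_contra hne
    have : 0 < v 0 * a ^ 2 := by have := hv 0; positivity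
    linarith
  have hb0 : b = 0 := by
    rw [ha0, zero_add] at e0
    rcases mul_eq_zero.1 e0 with h | h
    · exact absurd h hr0.ne'
    · exact (mul_eq_zero.1 h).resolve_left hx
  rw [ha, hb, ha0, hb0]
  simp

lemma wc_shift (ρ β : ℝ) (hρ : 0 < ρ) (hβ : 0 < β) (n k : ℕ) :
    wc ρ (β + k) n * ∏ i ∈ Finset.range k, (1 + ρ * n / (β + i)) = wc ρ β n := by
  induction k with
  | zero => simp
  | succ k ih =>
    rw [← ih, wc_rec ρ (β + k) hρ (by positivity) n, Finset.prod_range_succ]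
    push_cast
    rw [add_assoc β]
    ring

lemma wc_shift_le (ρ β : ℝ) (hρ : 0 < ρ) (hβ : 0 < β) (n k : ℕ) :
    wc ρ (β + k) n * (1 + ρ * n / (β + 1) * ∑ i ∈ Finset.range k, 1 / ((i : ℝ) + 1)) ≤ wc ρ β n := by
  rw [← wc_shift ρ β hρ hβ n k]
  apply mul_le_mul_of_nonneg_left _ (wc_pos ρ _ hρ (by positivity) n).le
  refine le_trans ?_ (sum_le_prod_one_add (fun i => ρ * n / (β + i)) (fun i => by positivity) k)
  rw [Finset.mul_sum]
  gcongr with i hi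
  rw [div_mul_div_comm, mul_one]
  apply div_le_div_of_nonneg_left (by positivity) (by positivity)
  have : (0 : ℝ) ≤ i := by positivity
  nlinarith

lemma FF_shift_tendsto (ρ β : ℝ) (hρ : 0 < ρ) (hβ : 0 < β) (z : ℂ) :
    Tendsto (fun k : ℕ => FF ρ (β + k) z) atTop (𝓝 1) := by
  have h1 : (1 : ℂ) = ∑' n : ℕ, (if n = 0 then (1 : ℂ) else 0) := by rw [tsum_ite_eq]
  rw [h1]
  unfold FF
  apply tendsto_tsum_of_dominated_convergence (wc_summable ρ β hρ hβ ‖z‖ (norm_nonneg z))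
  · intro n
    by_cases hn : n = 0
    · subst hn
      have : ∀ k : ℕ, wc ρ (β + k) 0 = 1 := by
        intro k
        unfold wc
        have : Real.Gamma (β + k) ≠ 0 := (Real.Gamma_pos_of_pos (by positivity)).ne'
        simp [this]
      simp [this]
    · rw [if_neg hn]
      have hn0 : (0 : ℝ) < n := by positivity
      have h2 : Tendsto (fun k : ℕ => wc ρ (β + k) n) atTop (𝓝 0) := by
        have h3 : Tendsto (fun k : ℕ => 1 + ρ * n / (β + 1) * ∑ i ∈ Finset.range k, 1 / ((i : ℝ) + 1))
            atTop atTop := by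
          apply tendsto_atTop_add_const_left
          exact Real.tendsto_sum_range_one_div_nat_succ_atTop.const_mul_atTop (by positivity)
        refine squeeze_zero (fun k => (wc_pos ρ _ hρ (by positivity) n).le) (fun k => ?_)
          ((tendsto_const_nhds (x := wc ρ β n)).div_atTop h3)
        have h4 : 0 ≤ ∑ i ∈ Finset.range k, 1 / ((i : ℝ) + 1) :=
          Finset.sum_nonneg fun i _ => by positivity
        rw [le_div_iff₀ (by positivity)]
        exact wc_shift_le ρ β hρ hβ n k
      have h5 := ((Complex.continuous_ofReal.tendsto _).comp h2).mul_const (z ^ n)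
      simpa [Function.comp_def] using h5
  · refine Eventually.of_forall fun k n => ?_
    rw [norm_term ρ (β + k) hρ (by positivity)]
    apply mul_le_mul_of_nonneg_right _ (by positivity)
    refine le_trans ?_ (wc_shift_le ρ β hρ hβ n k)
    apply le_mul_of_one_le_right (wc_pos ρ _ hρ (by positivity) n).le
    have h4 : 0 ≤ ∑ i ∈ Finset.range k, 1 / ((i : ℝ) + 1) :=
      Finset.sum_nonneg fun i _ => by positivity
    have : 0 ≤ ρ * n / (β + 1) * ∑ i ∈ Finset.range k, 1 / ((i : ℝ) + 1) := by positivity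
    linarith

lemma no_double (ρ β : ℝ) (hρ : 0 < ρ) (hβ : 0 < β) (x : ℝ) (hx : x ≠ 0)
    (h0 : FF ρ β x = 0) (h1 : deriv (FF ρ β) x = 0) : False := by
  have key : ∀ k : ℕ, FF ρ (β + k) x = 0 ∧ deriv (FF ρ (β + k)) x = 0 := by
    intro k
    induction k with
    | zero => simpa using ⟨h0, h1⟩
    | succ k ih =>
      have := double_step ρ (β + k) hρ (by positivity) x hx ih.1 ih.2
      push_cast
      rwa [← add_assoc]
  have h2 := FF_shift_tendsto ρ β hρ hβ x
  simp_rw [fun k => (key k).1] at h2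
  exact zero_ne_one (tendsto_nhds_unique tendsto_const_nhds h2)

lemma strictAnti_of_prod (ρ β : ℝ) (hρ : 0 < ρ) (hβ : 0 < β) (v : ℕ → ℝ) (hva : Antitone v)
    (hv : ∀ j, 0 < v j) (hvS : Summable v) (hF : ∀ z, FF ρ β z = ∏' j, (1 + z * v j)) :
    StrictAnti v := by
  apply hva.strictAnti_of_injective
  intro i j hij
  by_contra hne
  have hx : -(1 / v i) ≠ 0 := by have := hv i; simp [this.ne']
  have hzero : ∀ j, v j = v i → 1 + ((-(1 / v i) : ℝ) : ℂ) * v j = 0 := by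
    intro j hj
    rw [hj]
    have : -(1 / v i) * v i = -1 := by have := hv i; field_simp
    rw [← Complex.ofReal_mul, this]; simp
  obtain ⟨l1, l2, -⟩ := QQ_lim v (fun j => (hv j).le) hvS _ hF ((-(1 / v i) : ℝ) : ℂ)
  have e1 : ∀ k, QQ v (max i j + 1 + k) ((-(1 / v i) : ℝ) : ℂ) = 0 ∧
      deriv (QQ v (max i j + 1 + k)) ((-(1 / v i) : ℝ) : ℂ) = 0 := by
    intro k
    have hi : i ∈ Finset.range (max i j + 1 + k) := by simp; omega
    have hj : j ∈ (Finset.range (max i j + 1 + k)).erase i := by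
      simp only [Finset.mem_erase, Finset.mem_range]
      exact ⟨fun h => hne h.symm, by omega⟩
    refine ⟨Finset.prod_eq_zero hi (hzero i rfl), ?_⟩
    have hQ : QQ v (max i j + 1 + k) = fun z : ℂ => (1 + z * v i) * ((1 + z * v j) *
        ∏ l ∈ ((Finset.range (max i j + 1 + k)).erase i).erase j, (1 + z * v l)) := by
      funext z
      rw [Finset.mul_prod_erase _ (fun l => 1 + z * (v l : ℂ)) hj,
        Finset.mul_prod_erase _ (fun l => 1 + z * (v l : ℂ)) hi]
      rfl
    rw [hQ, deriv_fun_mul (by fun_prop) (by fun_prop), hzero i rfl, hzero j hij.symm]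
    simp
  have hs : Tendsto (fun k => max i j + 1 + k) atTop atTop := tendsto_atTop_mono
    (fun k => (by simp only [id]; omega : id k ≤ max i j + 1 + k)) tendsto_id
  have m1 := l1.comp hs
  have m2 := l2.comp hs
  simp only [Function.comp_def, fun k => (e1 k).1, fun k => (e1 k).2] at m1 m2
  exact no_double ρ β hρ hβ _ hx (tendsto_nhds_unique m1 tendsto_const_nhds)
    (tendsto_nhds_unique m2 tendsto_const_nhds)

end WrightAux

/-- `λ_{ρ,β}` has infinitely many zeros, all real, and admits the
infinite product representation over its positive zeros. -/
theorem wright_lam_infinite_product (ρ β : ℝ) (hρ : 0 < ρ) (hβ : 0 < β) :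
    {z : ℂ | lam ρ β z = 0}.Infinite ∧
    (∀ z : ℂ, lam ρ β z = 0 → z.im = 0) ∧
    ∃ ζ : ℕ → ℝ, StrictMono ζ ∧ (∀ n, 0 < ζ n) ∧
      (∀ x : ℝ, (0 < x ∧ lam ρ β (x : ℂ) = 0) ↔ ∃ n, ζ n = x) ∧
      ∀ z : ℂ, lam ρ β z = ∏' n : ℕ, (1 - z ^ 2 / ((ζ n : ℂ)) ^ 2) := by
  obtain ⟨v, hva, hv, hvS, hF⟩ := WrightAux.FF_prod ρ β hρ hβ
  have hanti := WrightAux.strictAnti_of_prod ρ β hρ hβ v hva hv hvS hF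
  set ζ : ℕ → ℝ := fun n => 1 / Real.sqrt (v n) with hζ
  have hζ0 : ∀ n, 0 < ζ n := fun n => one_div_pos.2 (Real.sqrt_pos.2 (hv n))
  have hζ2 : ∀ n, (ζ n) ^ 2 = 1 / v n := fun n => by
    simp only [hζ]
    rw [div_pow, one_pow, Real.sq_sqrt (hv n).le]
  have hζC : ∀ n, (v n : ℂ) * (ζ n : ℂ) ^ 2 = 1 := fun n => by
    rw [← Complex.ofReal_pow, ← Complex.ofReal_mul, hζ2, mul_one_div_cancel (hv n).ne']
    simp
  have hvC : ∀ n, (v n : ℂ) ≠ 0 := fun n => by exact_mod_cast (hv n).ne'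
  have hmono : StrictMono ζ := fun i j hij =>
    one_div_lt_one_div_of_lt (Real.sqrt_pos.2 (hv j)) (Real.sqrt_lt_sqrt (hv j).le (hanti hij))
  have hlam : ∀ z : ℂ, lam ρ β z = ∏' n : ℕ, (1 + (-z ^ 2) * (v n : ℂ)) := fun z => by
    rw [WrightAux.lam_eq, hF]
  have hzero : ∀ z : ℂ, lam ρ β z = 0 ↔ ∃ n, z = ζ n ∨ z = -ζ n := by
    intro z
    have hfac : ∀ n, 1 + (-z ^ 2) * (v n : ℂ) = 0 ↔ (z = ζ n ∨ z = -ζ n) := by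
      intro n
      rw [← sq_eq_sq_iff_eq_or_eq_neg]
      constructor
      · intro h
        apply mul_left_cancel₀ (hvC n)
        rw [hζC]
        linear_combination -h
      · intro h
        rw [h]
        linear_combination -(hζC n)
    rw [hlam]
    constructor
    · intro h
      by_contra hne
      push Not at hne
      refine tprod_one_add_ne_zero_of_summable (f := fun n => (-z ^ 2) * (v n : ℂ)) (fun n hn => ?_)
        (WrightAux.mult_aux v (fun j => (hv j).le) hvS (-z ^ 2)) h
      rcases (hfac n).1 hn with h1 | h1
      · exact (hne n).1 h1
      · exact (hne n).2 h1
    · rintro ⟨n, hn⟩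
      exact tprod_of_exists_eq_zero ⟨n, (hfac n).2 hn⟩
  refine ⟨?_, ?_, ζ, hmono, hζ0, ?_, ?_⟩
  · refine Set.infinite_of_injective_forall_mem (f := fun n : ℕ => (ζ n : ℂ)) ?_ ?_
    · intro i j hij
      exact hmono.injective (Complex.ofReal_injective hij)
    · intro n
      exact (hzero _).2 ⟨n, Or.inl rfl⟩
  · intro z hz
    obtain ⟨n, h | h⟩ := (hzero z).1 hz <;> rw [h] <;> simp
  · intro x
    constructor
    · rintro ⟨hx, h⟩
      obtain ⟨n, h1 | h1⟩ := (hzero _).1 h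
      · exact ⟨n, (Complex.ofReal_injective h1).symm⟩
      · have h2 : x = - ζ n := by exact_mod_cast h1
        have := hζ0 n
        linarith
    · rintro ⟨n, rfl⟩
      exact ⟨hζ0 n, (hzero _).2 ⟨n, Or.inl rfl⟩⟩
  · intro z
    rw [hlam]
    refine tprod_congr fun n => ?_
    have h1 : (ζ n : ℂ) ^ 2 ≠ 0 := fun h => by
      have := hζC n
      rw [h, mul_zero] at this
      exact zero_ne_one this
    have h2 : (v n : ℂ) = 1 / (ζ n : ℂ) ^ 2 := by
      rw [eq_div_iff h1]; exact hζC n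
    rw [h2]
    ring
end

section
/- Let ρ>0 and β>0. The function r ↦ r·g′_{ρ,β}(r)/g_{ρ,β}(r) is strictly decreasing on the interval (0,ζ₁), where ζ₁ is the smallest positive zero of λ_{ρ,β}(z)=Γ(β)·W_{ρ,β}(−z²); moreover it tends to 1 as r→0⁺ and to −∞ as r→ζ₁⁻. Consequently, for every c∈(−∞,1) the equation r·g′_{ρ,β}(r)/g_{ρ,β}(r)=c has a unique root in (0,ζ₁). -/
open Complex Filter Set

section WPoly
open Polynomial

/-- Real-rooted with positive roots. -/
def WGood (P : ℝ[X]) : Prop := P.Splits ∧ ∀ a, P.eval a = 0 → 0 < a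

lemma WGood.ne_zero {P : ℝ[X]} (h : WGood P) : P ≠ 0 := by
  rintro rfl
  have := h.2 0 (by simp)
  exact lt_irrefl _ this

lemma w_im_sum (z : ℂ) (s : Multiset ℝ) :
    (s.map (fun a : ℝ => 1 / (z - (a : ℂ)))).sum.im * z.im ≤ 0 := by
  induction s using Multiset.induction_on with
  | empty => simp
  | cons a s ih =>
    rw [Multiset.map_cons, Multiset.sum_cons, Complex.add_im, add_mul]
    have : (1 / (z - (a : ℂ))).im * z.im ≤ 0 := by
      rw [one_div, Complex.inv_im]
      simp only [Complex.sub_im, Complex.ofReal_im, sub_zero]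
      have := Complex.normSq_nonneg (z - a)
      rw [div_mul_eq_mul_div]
      apply div_nonpos_of_nonpos_of_nonneg _ this
      nlinarith [sq_nonneg z.im]
    linarith

lemma w_re_sum (x : ℝ) (hx : x ≤ 0) (s : Multiset ℝ) (hs : ∀ a ∈ s, 0 < a) :
    (s.map (fun a : ℝ => 1 / ((x : ℂ) - (a : ℂ)))).sum.re ≤ 0 := by
  induction s using Multiset.induction_on with
  | empty => simp
  | cons a s ih =>
    rw [Multiset.map_cons, Multiset.sum_cons, Complex.add_re]
    have h1 := ih (fun b hb => hs b (Multiset.mem_cons_of_mem hb))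
    have ha := hs a (Multiset.mem_cons_self a s)
    have : (1 / ((x : ℂ) - (a : ℂ))).re ≤ 0 := by
      have : (1 / ((x : ℂ) - (a : ℂ))) = ((1 / (x - a) : ℝ) : ℂ) := by push_cast; rfl
      rw [this, Complex.ofReal_re]
      apply div_nonpos_of_nonneg_of_nonpos <;> linarith
    linarith

lemma WGood.key {P : ℝ[X]} (h : WGood P) {ρ b : ℝ} (hρ : 0 < ρ) (hb : 0 < b) (z : ℂ)
    (hz : ((C ρ * (X * derivative P) + C b * P).map (algebraMap ℝ ℂ)).eval z = 0) :
    z.im = 0 ∧ 0 < z.re := by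
  set i := algebraMap ℝ ℂ
  have hP0 := h.ne_zero
  have hroots : (P.map i).roots = P.roots.map i := h.1.roots_map i
  have hpos : ∀ a ∈ P.roots, 0 < a := fun a ha => h.2 a (by simpa [hP0] using ha)
  by_cases hPz : (P.map i).eval z = 0
  · have : z ∈ (P.map i).roots := by
      rw [mem_roots (by simpa using hP0)]; exact hPz
    rw [hroots, Multiset.mem_map] at this
    obtain ⟨a, ha, rfl⟩ := this
    exact ⟨by simp [i], by simpa [i] using hpos a ha⟩
  · have hS : (P.map i).Splits := IsAlgClosed.splits _
    have hd := hS.eval_derivative_div_eval_of_ne_zero hPz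
    rw [hroots, Multiset.map_map] at hd
    set T := (P.roots.map ((fun w => 1 / (z - w)) ∘ i)).sum with hT
    have h1 := w_im_sum z P.roots
    have hTT : (P.roots.map (fun a : ℝ => 1 / (z - (a : ℂ)))).sum = T := rfl
    rw [hTT] at h1
    rw [div_eq_iff hPz] at hd
    have h2 : (ρ : ℂ) * (z * T) + b = 0 := by
      have : ((ρ : ℂ) * (z * T) + b) * (P.map i).eval z = 0 := by
        rw [← hz]
        simp only [Polynomial.map_add, Polynomial.map_mul, map_C, map_X, eval_add, eval_mul,
          eval_C, eval_X, ← derivative_map, hd]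
        simp only [i, Complex.coe_algebraMap]
        ring
      exact (mul_eq_zero.1 this).resolve_right hPz
    have hre := congrArg Complex.re h2
    have him := congrArg Complex.im h2
    simp at hre him
    have hzi : z.im = 0 := by
      by_contra hne
      have h3 : z.re * T.im + z.im * T.re = 0 := by
        rcases him with h | h
        · exact absurd h hρ.ne'
        · exact h
      have h4 : ρ * (z.re ^ 2 + z.im ^ 2) * (T.im * z.im) = b * z.im ^ 2 := by
        linear_combination ρ * z.re * z.im * h3 - z.im ^ 2 * hre
      have h5 : 0 < b * z.im ^ 2 := by positivity
      have h6 : ρ * (z.re ^ 2 + z.im ^ 2) * (T.im * z.im) ≤ 0 :=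
        mul_nonpos_of_nonneg_of_nonpos (by positivity) h1
      linarith
    refine ⟨hzi, ?_⟩
    by_contra hle
    push Not at hle
    have hzr : z = (z.re : ℂ) := by
      apply Complex.ext <;> simp [hzi]
    have h3 := w_re_sum z.re hle P.roots hpos
    rw [← hzr, hTT] at h3
    rw [hzi] at hre
    have : 0 ≤ z.re * T.re := mul_nonneg_of_nonpos_of_nonpos hle h3
    have : 0 ≤ ρ * (z.re * T.re) := by positivity
    linarith

lemma WGood.step {P : ℝ[X]} (h : WGood P) {ρ b : ℝ} (hρ : 0 < ρ) (hb : 0 < b) :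
    WGood (C ρ * (X * derivative P) + C b * P) := by
  constructor
  · apply Splits.of_splits_map (algebraMap ℝ ℂ) (IsAlgClosed.splits _)
    intro z hz
    have := (h.key hρ hb z (mem_roots'.1 hz).2).1
    exact ⟨z.re, by apply Complex.ext <;> simp [this]⟩
  · intro a ha
    have := h.key hρ hb (a : ℂ) (by
      have := congrArg (algebraMap ℝ ℂ) ha
      rw [← Polynomial.eval_map_apply] at this
      simpa using this)
    simpa using this.2

/-- Laguerre inequality. -/
lemma w_lag_aux (c : ℝ) (s : Multiset ℝ) (hs : ∀ a ∈ s, 0 < a) (x : ℝ) (hx : 0 ≤ x) :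
    let P := C c * (s.map (fun a => X - C a)).prod
    P.eval x * (X * derivative (X * derivative P)).eval x ≤ ((X * derivative P).eval x) ^ 2 := by
  induction s using Multiset.induction_on with
  | empty => simp
  | cons a s ih =>
    have h1 := ih (fun b hb => hs b (Multiset.mem_cons_of_mem hb))
    have ha := hs a (Multiset.mem_cons_self a s)
    simp only [Multiset.map_cons, Multiset.prod_cons]
    rw [mul_left_comm]
    set Q := C c * (s.map (fun a => X - C a)).prod
    simp only [derivative_mul, derivative_X, derivative_sub, derivative_C, derivative_add,
      eval_mul, eval_add, eval_sub, eval_X, eval_C, eval_one, eval_zero, derivative_one,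
      derivative_zero] at h1 ⊢
    set q := Q.eval x
    set q1 := (derivative Q).eval x
    set q2 := (derivative (derivative Q)).eval x
    have h2 : 0 ≤ (x - a) ^ 2 * ((x * q1) ^ 2 - q * (x * (1 * q1 + x * q2))) :=
      mul_nonneg (sq_nonneg _) (by linarith)
    have h3 : 0 ≤ q ^ 2 * (a * x) := by positivity
    nlinarith

lemma WGood.lag {P : ℝ[X]} (h : WGood P) (x : ℝ) (hx : 0 ≤ x) :
    P.eval x * (X * derivative (X * derivative P)).eval x ≤ ((X * derivative P).eval x) ^ 2 := by
  have := w_lag_aux P.leadingCoeff P.roots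
    (fun a ha => h.2 a (by simpa [h.ne_zero] using ha)) x hx
  rw [h.1.eq_prod_roots]
  exact this

lemma w_coeff_D (P : ℝ[X]) (n : ℕ) : (X * derivative P).coeff n = n * P.coeff n := by
  cases n with
  | zero => simp
  | succ n => rw [coeff_X_mul, coeff_derivative]; push_cast; ring

/-- approximating polynomials -/
noncomputable def wP (ρ β : ℝ) (N : ℕ) : ℕ → ℝ[X]
  | 0 => (1 - C ((N : ℝ)⁻¹) * X) ^ N
  | k + 1 => C ρ * (X * derivative (wP ρ β N k)) + C (β + k) * wP ρ β N k

lemma wP_good (ρ β : ℝ) (hρ : 0 < ρ) (hβ : 0 < β) (N : ℕ) (hN : N ≠ 0) (k : ℕ) :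
    WGood (wP ρ β N k) := by
  induction k with
  | zero =>
    rw [wP]
    have hN' : (0 : ℝ) < N := by positivity
    constructor
    · apply Splits.pow
      apply Splits.of_natDegree_le_one
      compute_degree
    · intro a ha
      simp [hN] at ha
      have : a = N := by field_simp at ha; linarith
      rw [this]; exact hN'
  | succ k ih => exact ih.step hρ (by positivity)

lemma wP_coeff (ρ β : ℝ) (N k n : ℕ) :
    (wP ρ β N k).coeff n =
      (N.choose n : ℝ) * (-(N : ℝ)⁻¹) ^ n * ∏ j ∈ Finset.range k, (ρ * n + β + j) := by
  induction k with
  | zero =>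
    rw [wP]
    have : (1 - C ((N : ℝ)⁻¹) * X : ℝ[X]) ^ N = ((1 + X : ℝ[X]) ^ N).comp (C (-(N : ℝ)⁻¹) * X) := by
      simp [sub_eq_add_neg]
    rw [this, comp_C_mul_X_coeff, coeff_one_add_X_pow]
    simp
  | succ k ih =>
    rw [wP, coeff_add, coeff_C_mul, coeff_C_mul, w_coeff_D, ih, Finset.prod_range_succ]
    ring

lemma w_eval_tsum (P : ℝ[X]) (x : ℝ) : P.eval x = ∑' n : ℕ, P.coeff n * x ^ n := by
  rw [tsum_eq_sum (s := Finset.range (P.natDegree + 1)), eval_eq_sum_range]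
  intro n hn
  rw [coeff_eq_zero_of_natDegree_lt (by simpa using hn)]; simp

end WPoly

section WSeq

noncomputable def wA (ρ β : ℝ) (n : ℕ) : ℝ :=
  (-1) ^ n / n.factorial * (Real.Gamma β / Real.Gamma (ρ * n + β))

noncomputable def wB (ρ β : ℝ) (N n : ℕ) : ℝ :=
  (wP ρ β N (N + 1)).coeff n / (∏ j ∈ Finset.range (N + 1), (β + j)) * ((N : ℝ) ^ (-ρ)) ^ n

lemma wB_eq (ρ β : ℝ) (hρ : 0 < ρ) (hβ : 0 < β) (N n : ℕ) (hN : N ≠ 0) :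
    wB ρ β N n = ((N.choose n : ℝ) * (-(N : ℝ)⁻¹) ^ n) *
      (Real.GammaSeq β N / Real.GammaSeq (ρ * n + β) N) := by
  have hN' : (0 : ℝ) < N := by positivity
  rw [wB, wP_coeff, Real.GammaSeq, Real.GammaSeq]
  have h1 : 0 < ∏ j ∈ Finset.range (N + 1), (β + (j : ℝ)) :=
    Finset.prod_pos fun j _ => by positivity
  have h2 : 0 < ∏ j ∈ Finset.range (N + 1), (ρ * n + β + (j : ℝ)) :=
    Finset.prod_pos fun j _ => by positivity
  rw [Real.rpow_add hN', Real.rpow_mul hN'.le, Real.rpow_natCast, Real.rpow_neg hN'.le]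
  have h3 : 0 < (N : ℝ) ^ ρ := by positivity
  have h4 : 0 < (N : ℝ) ^ β := by positivity
  field_simp
  rw [mul_assoc, ← mul_pow, one_div_mul_cancel h3.ne', one_pow, mul_one]

lemma wB_tendsto (ρ β : ℝ) (hρ : 0 < ρ) (hβ : 0 < β) (n : ℕ) :
    Tendsto (fun N => wB ρ β N n) atTop (nhds (wA ρ β n)) := by
  have h1 : Tendsto (fun N : ℕ => (N.choose n : ℝ) * (-(N : ℝ)⁻¹) ^ n) atTop
      (nhds ((-1) ^ n / n.factorial)) := by
    apply ProbabilityTheory.tendsto_choose_mul_pow_atTop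
    apply tendsto_const_nhds.congr'
    filter_upwards [eventually_ne_atTop 0] with N hN
    have : (N : ℝ) ≠ 0 := by positivity
    field_simp
  have hg : Real.Gamma (ρ * n + β) ≠ 0 := (Real.Gamma_pos_of_pos (by positivity)).ne'
  have h2 := h1.mul ((Real.GammaSeq_tendsto_Gamma β).div
    (Real.GammaSeq_tendsto_Gamma (ρ * n + β)) hg)
  apply h2.congr'
  filter_upwards [eventually_ne_atTop 0] with N hN
  rw [wB_eq ρ β hρ hβ N n hN]; rfl

lemma w_sum_bound (β : ℝ) (hβ : 0 < β) (N : ℕ) :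
    ∑ j ∈ Finset.range (N + 1), 1 / (β + (j : ℝ)) ≤ 1 / β + 1 + Real.log N := by
  rw [Finset.sum_range_succ']
  have h := harmonic_le_one_add_log N
  have h2 : ∑ j ∈ Finset.range N, 1 / (β + ((j + 1 : ℕ) : ℝ)) ≤ ((harmonic N : ℚ) : ℝ) := by
    rw [harmonic]
    push_cast
    apply Finset.sum_le_sum
    intro j _
    rw [one_div]
    apply inv_anti₀ (by positivity) (by linarith)
  simp only [Nat.cast_zero, add_zero]
  linarith

lemma wB_bound (ρ β : ℝ) (hρ : 0 < ρ) (hβ : 0 < β) (N n : ℕ) (hN : N ≠ 0) :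
    |wB ρ β N n| ≤ Real.exp (ρ * (1 / β + 1)) ^ n / n.factorial := by
  have hN' : (0 : ℝ) < N := by positivity
  have h1 : ∀ j : ℕ, 0 < β + (j : ℝ) := fun j => by positivity
  have h2 : (∏ j ∈ Finset.range (N + 1), (ρ * n + β + (j : ℝ))) /
      ∏ j ∈ Finset.range (N + 1), (β + (j : ℝ)) ≤
      Real.exp (ρ * n * (1 / β + 1 + Real.log N)) := by
    rw [← Finset.prod_div_distrib]
    calc ∏ j ∈ Finset.range (N + 1), ((ρ * n + β + (j : ℝ)) / (β + j))
        ≤ ∏ j ∈ Finset.range (N + 1), Real.exp (ρ * n * (1 / (β + j))) := by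
          apply Finset.prod_le_prod
          · intro j _; have := h1 j; positivity
          · intro j _
            have := h1 j
            have e : (ρ * n + β + (j : ℝ)) / (β + j) = ρ * n * (1 / (β + j)) + 1 := by
              field_simp; ring
            rw [e]; exact Real.add_one_le_exp _
      _ = Real.exp (ρ * n * ∑ j ∈ Finset.range (N + 1), 1 / (β + (j : ℝ))) := by
          rw [← Real.exp_sum, Finset.mul_sum]
      _ ≤ _ := by
          apply Real.exp_le_exp.2
          apply mul_le_mul_of_nonneg_left (w_sum_bound β hβ N) (by positivity)
  have h3 : Real.exp (ρ * n * (1 / β + 1 + Real.log N)) * ((N : ℝ) ^ (-ρ)) ^ n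
      = Real.exp (ρ * (1 / β + 1)) ^ n := by
    rw [Real.rpow_def_of_pos hN', ← Real.exp_nat_mul, ← Real.exp_nat_mul, ← Real.exp_add]
    congr 1; ring
  have h4 : |(N.choose n : ℝ) * (-(N : ℝ)⁻¹) ^ n| ≤ 1 / n.factorial := by
    rw [abs_mul, abs_pow, abs_neg, abs_inv, Nat.abs_cast, Nat.abs_cast]
    have := Nat.choose_le_pow_div (α := ℝ) n N
    calc (N.choose n : ℝ) * ((N : ℝ)⁻¹) ^ n ≤ (N : ℝ) ^ n / n.factorial * ((N : ℝ)⁻¹) ^ n := by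
          gcongr
      _ = _ := by rw [inv_pow]; field_simp
  have hp : 0 ≤ (∏ j ∈ Finset.range (N + 1), (ρ * n + β + (j : ℝ))) /
      ∏ j ∈ Finset.range (N + 1), (β + (j : ℝ)) :=
    div_nonneg (Finset.prod_nonneg fun j _ => by positivity)
      (Finset.prod_nonneg fun j _ => (h1 j).le)
  have hq : 0 ≤ ((N : ℝ) ^ (-ρ)) ^ n := by positivity
  rw [wB, wP_coeff, mul_div_assoc, mul_assoc, abs_mul, abs_of_nonneg (mul_nonneg hp hq)]
  calc _ ≤ 1 / (n.factorial : ℝ) * (Real.exp (ρ * n * (1 / β + 1 + Real.log N)) *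
        ((N : ℝ) ^ (-ρ)) ^ n) := by gcongr
    _ = _ := by rw [h3]; ring

lemma wA_bound (ρ β : ℝ) (hρ : 0 < ρ) (hβ : 0 < β) (n : ℕ) :
    |wA ρ β n| ≤ Real.exp (ρ * (1 / β + 1)) ^ n / n.factorial := by
  apply le_of_tendsto (wB_tendsto ρ β hρ hβ n).abs
  filter_upwards [eventually_ne_atTop 0] with N hN
  exact wB_bound ρ β hρ hβ N n hN

lemma w_summable (K x : ℝ) (hK : 0 ≤ K) (hx : 0 ≤ x) (j : ℕ) :
    Summable (fun n : ℕ => (n : ℝ) ^ j * (K ^ n / n.factorial) * x ^ n) := by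
  have h := (Real.summable_pow_div_factorial (Real.exp j * K * x))
  apply h.of_nonneg_of_le (fun n => by positivity)
  intro n
  have : (n : ℝ) ^ j ≤ Real.exp j ^ n := by
    calc (n : ℝ) ^ j ≤ Real.exp n ^ j := by
          gcongr
          linarith [Real.add_one_le_exp (n : ℝ)]
      _ = _ := by rw [← Real.exp_nat_mul, ← Real.exp_nat_mul, mul_comm]
  calc _ ≤ Real.exp j ^ n * (K ^ n / n.factorial) * x ^ n := by gcongr
    _ = _ := by rw [mul_pow, mul_pow]; ring

noncomputable def wS (ρ β : ℝ) (j : ℕ) (x : ℝ) : ℝ := ∑' n : ℕ, (n : ℝ) ^ j * wA ρ β n * x ^ n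

lemma wB_tendsto_tsum (ρ β : ℝ) (hρ : 0 < ρ) (hβ : 0 < β) (j : ℕ) (x : ℝ) (hx : 0 ≤ x) :
    Tendsto (fun N => ∑' n : ℕ, (n : ℝ) ^ j * wB ρ β N n * x ^ n) atTop (nhds (wS ρ β j x)) := by
  apply tendsto_tsum_of_dominated_convergence
    (w_summable (Real.exp (ρ * (1 / β + 1))) x (Real.exp_pos _).le hx j)
  · intro n
    exact ((wB_tendsto ρ β hρ hβ n).const_mul _).mul_const _
  · filter_upwards [eventually_ne_atTop 0] with N hN n
    rw [Real.norm_eq_abs, abs_mul, abs_mul, abs_of_nonneg (pow_nonneg hx n),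
      abs_of_nonneg (by positivity : (0 : ℝ) ≤ (n : ℝ) ^ j)]
    gcongr
    exact wB_bound ρ β hρ hβ N n hN

lemma wB_tsum (ρ β : ℝ) (N : ℕ) (x : ℝ) (j : ℕ) (Q : Polynomial ℝ)
    (hQ : ∀ n, Q.coeff n = (n : ℝ) ^ j * (wP ρ β N (N + 1)).coeff n) :
    ∑' n : ℕ, (n : ℝ) ^ j * wB ρ β N n * x ^ n =
      (∏ j ∈ Finset.range (N + 1), (β + (j : ℝ)))⁻¹ * Q.eval ((N : ℝ) ^ (-ρ) * x) := by
  rw [w_eval_tsum, ← tsum_mul_left]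
  congr 1; ext n
  rw [hQ, wB, mul_pow]; ring

lemma wS_lag (ρ β : ℝ) (hρ : 0 < ρ) (hβ : 0 < β) (x : ℝ) (hx : 0 ≤ x) :
    wS ρ β 0 x * wS ρ β 2 x ≤ wS ρ β 1 x ^ 2 := by
  apply le_of_tendsto_of_tendsto
    ((wB_tendsto_tsum ρ β hρ hβ 0 x hx).mul (wB_tendsto_tsum ρ β hρ hβ 2 x hx))
    ((wB_tendsto_tsum ρ β hρ hβ 1 x hx).pow 2)
  filter_upwards [eventually_ne_atTop 0] with N hN
  set P := wP ρ β N (N + 1) with hP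
  rw [wB_tsum ρ β N x 0 P (by simp [hP]),
    wB_tsum ρ β N x 1 (Polynomial.X * Polynomial.derivative P)
      (fun n => by rw [w_coeff_D]; simp [hP]),
    wB_tsum ρ β N x 2 (Polynomial.X * Polynomial.derivative
      (Polynomial.X * Polynomial.derivative P))
      (fun n => by rw [w_coeff_D, w_coeff_D]; ring)]
  have h := (wP_good ρ β hρ hβ N hN (N + 1)).lag ((N : ℝ) ^ (-ρ) * x) (by positivity)
  have h2 := mul_le_mul_of_nonneg_left h
    (sq_nonneg (∏ j ∈ Finset.range (N + 1), (β + (j : ℝ)))⁻¹)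
  rw [← hP] at h2
  linarith

end WSeq

section WAna

noncomputable def wT (ρ β : ℝ) (j : ℕ) (z : ℂ) : ℂ :=
  ∑' n : ℕ, (((n : ℝ) ^ j * wA ρ β n : ℝ) : ℂ) * z ^ n

lemma wT_ofReal (ρ β : ℝ) (j : ℕ) (x : ℝ) : wT ρ β j (x : ℂ) = ((wS ρ β j x : ℝ) : ℂ) := by
  rw [wT, wS, Complex.ofReal_tsum]
  congr 1; ext n; push_cast; ring

lemma wT_hasDerivAt (ρ β : ℝ) (hρ : 0 < ρ) (hβ : 0 < β) (j : ℕ) (z : ℂ) :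
    ∃ D, HasDerivAt (wT ρ β j) D z ∧ z * D = wT ρ β (j + 1) z := by
  set K := Real.exp (ρ * (1 / β + 1)) with hK
  have hK0 : 0 ≤ K := (Real.exp_pos _).le
  set R := ‖z‖ + 1 with hR
  have hR1 : 1 ≤ R := by rw [hR]; linarith [norm_nonneg z]
  have hu := w_summable K R hK0 (by linarith) (j + 1)
  refine ⟨∑' n : ℕ, (((n : ℝ) ^ j * wA ρ β n : ℝ) : ℂ) * (n * z ^ (n - 1)), ?_, ?_⟩
  · change HasDerivAt (fun z : ℂ => ∑' n : ℕ, (((n : ℝ) ^ j * wA ρ β n : ℝ) : ℂ) * z ^ n) _ z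
    apply hasDerivAt_tsum_of_isPreconnected hu (t := Metric.ball (0 : ℂ) R)
      (g := fun (n : ℕ) (z : ℂ) => (((n : ℝ) ^ j * wA ρ β n : ℝ) : ℂ) * z ^ n)
      (g' := fun (n : ℕ) (z : ℂ) => (((n : ℝ) ^ j * wA ρ β n : ℝ) : ℂ) * (n * z ^ (n - 1)))
      Metric.isOpen_ball
      (convex_ball _ _).isPreconnected (y₀ := 0)
    · intro n y _
      exact (hasDerivAt_pow n y).const_mul _
    · intro n y hy
      have hy' : ‖y‖ ≤ R := by simpa using (Metric.mem_ball.1 hy).le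
      rw [norm_mul, Complex.norm_real, Real.norm_eq_abs, norm_mul, norm_pow,
        Complex.norm_natCast, abs_mul, abs_of_nonneg (by positivity : (0 : ℝ) ≤ (n : ℝ) ^ j)]
      have h1 : ‖y‖ ^ (n - 1) ≤ R ^ n :=
        (pow_le_pow_left₀ (norm_nonneg y) hy' _).trans (pow_le_pow_right₀ hR1 (Nat.sub_le _ _))
      calc (n : ℝ) ^ j * |wA ρ β n| * (n * ‖y‖ ^ (n - 1))
          ≤ (n : ℝ) ^ j * (K ^ n / n.factorial) * (n * R ^ n) := by
            gcongr
            exact wA_bound ρ β hρ hβ n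
        _ = _ := by ring
    · simp only [Metric.mem_ball, dist_self]; linarith
    · apply summable_of_ne_finset_zero (s := {0})
      intro n hn
      have : n ≠ 0 := by simpa using hn
      simp [this]
    · simp [hR]
  · rw [wT, ← tsum_mul_left]
    congr 1; ext n
    cases n with
    | zero => simp
    | succ n => rw [Nat.add_sub_cancel]; push_cast; ring

lemma wT_diff (ρ β : ℝ) (hρ : 0 < ρ) (hβ : 0 < β) (j : ℕ) : Differentiable ℂ (wT ρ β j) :=
  fun z => (wT_hasDerivAt ρ β hρ hβ j z).choose_spec.1.differentiableAt

lemma wS_hasDerivAt (ρ β : ℝ) (hρ : 0 < ρ) (hβ : 0 < β) (j : ℕ) (x : ℝ) :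
    ∃ d, HasDerivAt (wS ρ β j) d x ∧ x * d = wS ρ β (j + 1) x := by
  obtain ⟨D, hD, h⟩ := wT_hasDerivAt ρ β hρ hβ j (x : ℂ)
  refine ⟨D.re, ?_, ?_⟩
  · have := hD.real_of_complex
    simpa only [wT_ofReal, Complex.ofReal_re] using this
  · rw [wT_ofReal] at h
    simpa using congrArg Complex.re h

lemma wS_cont (ρ β : ℝ) (hρ : 0 < ρ) (hβ : 0 < β) (j : ℕ) : Continuous (wS ρ β j) :=
  continuous_iff_continuousAt.2
    fun x => (wS_hasDerivAt ρ β hρ hβ j x).choose_spec.1.continuousAt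

lemma wS_zero_zero (ρ β : ℝ) (hβ : 0 < β) : wS ρ β 0 0 = 1 := by
  rw [wS, tsum_eq_single 0 (by intro n hn; simp [hn])]
  simp [wA, (Real.Gamma_pos_of_pos hβ).ne']

lemma wS_one_zero (ρ β : ℝ) : wS ρ β 1 0 = 0 := by
  rw [wS, tsum_eq_single 0 (by intro n hn; simp [hn])]
  simp

lemma lam_eq (ρ β : ℝ) (z : ℂ) : lam ρ β z = wT ρ β 0 (z ^ 2) := by
  rw [lam, wright, wT, ← tsum_mul_left]
  congr 1; ext n
  rw [Complex.Gamma_ofReal, Complex.Gamma_ofReal, neg_pow]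
  simp only [wA]
  push_cast
  rw [div_eq_mul_inv, div_eq_mul_inv, div_eq_mul_inv, mul_inv]
  ring

lemma gw_deriv (ρ β : ℝ) (hρ : 0 < ρ) (hβ : 0 < β) (z : ℂ) :
    deriv (gw ρ β) z = wT ρ β 0 (z ^ 2) + 2 * wT ρ β 1 (z ^ 2) := by
  have hg : gw ρ β = fun z => z * wT ρ β 0 (z ^ 2) := by
    ext z; rw [gw, lam_eq]
  obtain ⟨D, hD, h⟩ := wT_hasDerivAt ρ β hρ hβ 0 (z ^ 2)
  have h1 : HasDerivAt (fun z : ℂ => wT ρ β 0 (z ^ 2)) (D * (2 * z)) z := by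
    have := HasDerivAt.comp z hD (hasDerivAt_pow 2 z)
    rw [show D * (2 * z) = D * ((2 : ℕ) * z ^ (2 - 1)) by simp]
    exact this
  have h2 := (hasDerivAt_id z).mul h1
  rw [hg]
  have h3 := h2.deriv
  simp only [id] at h3
  rw [show (fun z => z * wT ρ β 0 (z ^ 2)) = (id * fun z : ℂ => wT ρ β 0 (z ^ 2)) from rfl, h3,
    ← h]
  ring

lemma w_ratio (ρ β : ℝ) (hρ : 0 < ρ) (hβ : 0 < β) (r : ℝ) (hr : r ≠ 0)
    (h0 : wS ρ β 0 (r ^ 2) ≠ 0) :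
    (r : ℂ) * deriv (gw ρ β) (r : ℂ) / gw ρ β (r : ℂ) =
      ((1 + 2 * (wS ρ β 1 (r ^ 2) / wS ρ β 0 (r ^ 2)) : ℝ) : ℂ) := by
  rw [gw_deriv ρ β hρ hβ, gw, lam_eq, ← Complex.ofReal_pow, wT_ofReal, wT_ofReal]
  have : (r : ℂ) * ((wS ρ β 0 (r ^ 2) : ℝ) + 2 * (wS ρ β 1 (r ^ 2) : ℝ)) /
    ((r : ℂ) * (wS ρ β 0 (r ^ 2) : ℝ)) = ((r * (wS ρ β 0 (r ^ 2) + 2 * wS ρ β 1 (r ^ 2)) /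
      (r * wS ρ β 0 (r ^ 2)) : ℝ) : ℂ) := by push_cast; rfl
  rw [this]
  congr 1
  field_simp

variable {ρ β X : ℝ}

lemma w_pos (hρ : 0 < ρ) (hβ : 0 < β)
    (hX : ∀ x, 0 < x → x < X → wS ρ β 0 x ≠ 0) (x : ℝ) (hx : 0 ≤ x) (hxX : x < X) :
    0 < wS ρ β 0 x := by
  by_contra hle
  push Not at hle
  have hc := (wS_cont ρ β hρ hβ 0).continuousOn (s := Icc 0 x)
  have := intermediate_value_Icc' hx hc
  obtain ⟨y, hy, hy0⟩ := this ⟨hle, by rw [wS_zero_zero ρ β hβ]; norm_num⟩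
  rcases hy.1.eq_or_lt with h | h
  · rw [← h, wS_zero_zero ρ β hβ] at hy0; norm_num at hy0
  · exact hX y h (hy.2.trans_lt hxX) hy0

lemma w_anti (hρ : 0 < ρ) (hβ : 0 < β)
    (hX : ∀ x, 0 < x → x < X → wS ρ β 0 x ≠ 0) :
    AntitoneOn (fun x => wS ρ β 1 x / wS ρ β 0 x) (Ioo 0 X) := by
  have hd : ∀ x ∈ Ioo 0 X, ∃ d, HasDerivAt (fun x => wS ρ β 1 x / wS ρ β 0 x) d x ∧ d ≤ 0 := by
    intro x hx
    obtain ⟨d0, h0, e0⟩ := wS_hasDerivAt ρ β hρ hβ 0 x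
    obtain ⟨d1, h1, e1⟩ := wS_hasDerivAt ρ β hρ hβ 1 x
    refine ⟨_, h1.div h0 (hX x hx.1 hx.2), ?_⟩
    apply div_nonpos_of_nonpos_of_nonneg _ (sq_nonneg _)
    have hl := wS_lag ρ β hρ hβ x hx.1.le
    norm_num at e0 e1
    have : x * (d1 * wS ρ β 0 x - wS ρ β 1 x * d0) ≤ 0 := by
      calc _ = (x * d1) * wS ρ β 0 x - wS ρ β 1 x * (x * d0) := by ring
        _ ≤ 0 := by rw [e0, e1]; linarith
    by_contra hc
    push Not at hc
    have := mul_pos hx.1 hc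
    linarith
  apply antitoneOn_of_deriv_nonpos (convex_Ioo 0 X)
  · intro x hx
    obtain ⟨d, h, _⟩ := hd x hx
    exact h.continuousAt.continuousWithinAt
  · rw [interior_Ioo]
    intro x hx
    obtain ⟨d, h, _⟩ := hd x hx
    exact h.differentiableAt.differentiableWithinAt
  · rw [interior_Ioo]
    intro x hx
    obtain ⟨d, h, h'⟩ := hd x hx
    rw [h.deriv]; exact h'

lemma w_strictAnti (hρ : 0 < ρ) (hβ : 0 < β) (hX0 : 0 < X) (hXz : wS ρ β 0 X = 0)
    (hX : ∀ x, 0 < x → x < X → wS ρ β 0 x ≠ 0) :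
    StrictAntiOn (fun x => wS ρ β 1 x / wS ρ β 0 x) (Ioo 0 X) := by
  have ha := w_anti hρ hβ hX
  intro x hx y hy hxy
  apply lt_of_le_of_ne (ha hx hy hxy.le)
  intro heq
  simp only at heq
  set c := wS ρ β 1 x / wS ρ β 0 x with hc
  have h1 : ∀ t ∈ Ioo x y, wS ρ β 1 t = c * wS ρ β 0 t := by
    intro t ht
    have htX : t ∈ Ioo 0 X := ⟨hx.1.trans ht.1, ht.2.trans hy.2⟩
    have e1 := ha hx htX ht.1.le
    have e2 := ha htX hy ht.2.le
    simp only at e1 e2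
    rw [← div_eq_iff (hX t htX.1 htX.2)]
    linarith
  have hA1 : AnalyticOnNhd ℂ (wT ρ β 1) univ :=
    (wT_diff ρ β hρ hβ 1).differentiableOn.analyticOnNhd isOpen_univ
  have hA2 : AnalyticOnNhd ℂ (fun z => (c : ℂ) * wT ρ β 0 z) univ :=
    ((wT_diff ρ β hρ hβ 0).const_mul _).differentiableOn.analyticOnNhd isOpen_univ
  obtain ⟨m, hm⟩ := exists_between hxy
  have hfr : ∃ᶠ z in nhdsWithin (m : ℂ) {(m : ℂ)}ᶜ, wT ρ β 1 z = (c : ℂ) * wT ρ β 0 z := by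
    have ht : Tendsto (fun t : ℝ => (t : ℂ)) (nhdsWithin m {m}ᶜ)
        (nhdsWithin (m : ℂ) {(m : ℂ)}ᶜ) := by
      apply tendsto_nhdsWithin_of_tendsto_nhds_of_eventually_within
      · exact (Complex.continuous_ofReal.tendsto m).mono_left nhdsWithin_le_nhds
      · filter_upwards [self_mem_nhdsWithin] with t ht
        simpa using ht
    apply ht.frequently
    apply Eventually.frequently
    filter_upwards [mem_nhdsWithin_of_mem_nhds (Ioo_mem_nhds hm.1 hm.2)] with t ht
    rw [wT_ofReal, wT_ofReal, h1 t ht]; push_cast; rfl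
  have hall := AnalyticOnNhd.eq_of_frequently_eq hA1 hA2 hfr
  have hallR : ∀ t : ℝ, wS ρ β 1 t = c * wS ρ β 0 t := by
    intro t
    have := congrFun hall (t : ℂ)
    simp only [wT_ofReal] at this
    exact_mod_cast this
  have hc0 : c = 0 := by
    have := hallR 0
    rw [wS_one_zero, wS_zero_zero ρ β hβ] at this
    linarith
  have hconst : wS ρ β 0 X = wS ρ β 0 0 := by
    obtain ⟨t, ht, hE⟩ := exists_hasDerivAt_eq_slope (wS ρ β 0) (fun _ => 0) hX0
      (wS_cont ρ β hρ hβ 0).continuousOn (by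
        intro t ht
        obtain ⟨d, h, e⟩ := wS_hasDerivAt ρ β hρ hβ 0 t
        norm_num at e
        rw [hallR t, hc0, zero_mul] at e
        have : d = 0 := (mul_eq_zero.1 e).resolve_left ht.1.ne'
        rwa [this] at h)
    have : X - 0 ≠ 0 := by simpa using hX0.ne'
    rw [eq_div_iff this] at hE
    linarith
  rw [hXz, wS_zero_zero ρ β hβ] at hconst
  norm_num at hconst

lemma w_unbdd (hρ : 0 < ρ) (hβ : 0 < β) (hX0 : 0 < X) (hXz : wS ρ β 0 X = 0)
    (hX : ∀ x, 0 < x → x < X → wS ρ β 0 x ≠ 0) (B : ℕ) :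
    ∃ x ∈ Ioo 0 X, wS ρ β 1 x / wS ρ β 0 x < -B := by
  by_contra hcon
  push Not at hcon
  have hm : MonotoneOn (fun x => wS ρ β 0 x * x ^ B) (Icc (X / 2) X) := by
    have hd : ∀ x ∈ Ioo (X / 2) X, ∃ d, HasDerivAt (fun x => wS ρ β 0 x * x ^ B) d x ∧ 0 ≤ d := by
      intro x hx
      have hx0 : 0 < x := by linarith [hx.1]
      obtain ⟨d0, h0, e0⟩ := wS_hasDerivAt ρ β hρ hβ 0 x
      refine ⟨_, h0.mul (hasDerivAt_pow B x), ?_⟩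
      norm_num at e0
      have hp := w_pos hρ hβ hX x hx0.le hx.2
      have h1 := hcon x ⟨hx0, hx.2⟩
      rw [le_div_iff₀ hp] at h1
      have h2 : x * (d0 * x ^ B + wS ρ β 0 x * (B * x ^ (B - 1))) =
          x ^ B * (wS ρ β 1 x + B * wS ρ β 0 x) := by
        rw [← e0]
        rcases Nat.eq_zero_or_pos B with h | h
        · subst h; simp
        · have : x ^ B = x * x ^ (B - 1) := by
            rw [← pow_succ']; congr 1; omega
          rw [this]; ring
      have h3 : 0 ≤ x ^ B * (wS ρ β 1 x + B * wS ρ β 0 x) :=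
        mul_nonneg (by positivity) (by linarith)
      rw [← h2] at h3
      exact nonneg_of_mul_nonneg_right h3 hx0
    apply monotoneOn_of_deriv_nonneg (convex_Icc _ _)
    · exact ((wS_cont ρ β hρ hβ 0).mul (continuous_pow B)).continuousOn
    · rw [interior_Icc]
      intro x hx
      obtain ⟨d, h, _⟩ := hd x hx
      exact h.differentiableAt.differentiableWithinAt
    · rw [interior_Icc]
      intro x hx
      obtain ⟨d, h, h'⟩ := hd x hx
      rw [h.deriv]; exact h'
  have h := hm (left_mem_Icc.2 (by linarith)) (right_mem_Icc.2 (by linarith)) (by linarith)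
  simp only [hXz, zero_mul] at h
  have hp := w_pos hρ hβ hX (X / 2) (by linarith) (by linarith)
  have : 0 < wS ρ β 0 (X / 2) * (X / 2) ^ B := by positivity
  linarith

end WAna

/-- `r ↦ r g′_{ρ,β}(r)/g_{ρ,β}(r)` is strictly decreasing on `(0,ζ₁)`,
tends to `1` as `r → 0⁺`, to `−∞` as `r → ζ₁⁻`, and hence for every `c < 1` the
equation `r g′_{ρ,β}(r)/g_{ρ,β}(r) = c` has a unique root in `(0,ζ₁)`. -/
theorem wright_g_ratio_strictAnti (ρ β : ℝ) (hρ : 0 < ρ) (hβ : 0 < β) (ζ₁ : ℝ)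
    (hζ : IsLeast {x : ℝ | 0 < x ∧ lam ρ β (x : ℂ) = 0} ζ₁) :
    StrictAntiOn (fun r : ℝ => ((r : ℂ) * deriv (gw ρ β) (r : ℂ) / gw ρ β (r : ℂ)).re)
      (Set.Ioo 0 ζ₁) ∧
    Filter.Tendsto (fun r : ℝ => ((r : ℂ) * deriv (gw ρ β) (r : ℂ) / gw ρ β (r : ℂ)).re)
      (nhdsWithin 0 (Set.Ioi 0)) (nhds 1) ∧
    Filter.Tendsto (fun r : ℝ => ((r : ℂ) * deriv (gw ρ β) (r : ℂ) / gw ρ β (r : ℂ)).re)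
      (nhdsWithin ζ₁ (Set.Iio ζ₁)) Filter.atBot ∧
    ∀ c : ℝ, c < 1 →
      ∃! r : ℝ, r ∈ Set.Ioo 0 ζ₁ ∧
        (r : ℂ) * deriv (gw ρ β) (r : ℂ) / gw ρ β (r : ℂ) = (c : ℂ) := by

  obtain ⟨⟨hζ0, hζz⟩, hmin⟩ := hζ
  set X := ζ₁ ^ 2 with hXdef
  have hX0 : 0 < X := by positivity
  have hXz : wS ρ β 0 X = 0 := by
    rw [lam_eq, ← Complex.ofReal_pow, wT_ofReal] at hζz
    exact_mod_cast hζz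
  have hX : ∀ x, 0 < x → x < X → wS ρ β 0 x ≠ 0 := by
    intro x hx hxX h
    have h1 : ζ₁ ≤ Real.sqrt x := by
      apply hmin
      refine ⟨Real.sqrt_pos.2 hx, ?_⟩
      rw [lam_eq, ← Complex.ofReal_pow, Real.sq_sqrt hx.le, wT_ofReal, h]; simp
    have := (Real.le_sqrt hζ0.le hx.le).1 h1
    linarith
  have hmem : ∀ r ∈ Ioo 0 ζ₁, r ^ 2 ∈ Ioo 0 X := fun r hr =>
    ⟨pow_pos hr.1 2, by rw [hXdef]; exact pow_lt_pow_left₀ hr.2 hr.1.le (by norm_num)⟩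
  set G : ℝ → ℝ := fun r => 1 + 2 * (wS ρ β 1 (r ^ 2) / wS ρ β 0 (r ^ 2)) with hG
  have hR : ∀ r ∈ Ioo 0 ζ₁,
      (r : ℂ) * deriv (gw ρ β) (r : ℂ) / gw ρ β (r : ℂ) = (G r : ℂ) := fun r hr =>
    w_ratio ρ β hρ hβ r hr.1.ne' (hX _ (hmem r hr).1 (hmem r hr).2)
  have hRre : ∀ r ∈ Ioo 0 ζ₁,
      ((r : ℂ) * deriv (gw ρ β) (r : ℂ) / gw ρ β (r : ℂ)).re = G r := fun r hr => by
    rw [hR r hr, Complex.ofReal_re]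
  have hanti : StrictAntiOn G (Ioo 0 ζ₁) := by
    intro a ha b hb hab
    have := w_strictAnti hρ hβ hX0 hXz hX (hmem a ha) (hmem b hb)
      (pow_lt_pow_left₀ hab ha.1.le (by norm_num))
    simp only [hG] at this ⊢
    linarith
  have hcontAt : ∀ r, wS ρ β 0 (r ^ 2) ≠ 0 → ContinuousAt G r := by
    intro r hr
    have c1 : ContinuousAt (fun r : ℝ => wS ρ β 1 (r ^ 2)) r :=
      ((wS_cont ρ β hρ hβ 1).comp (continuous_pow 2)).continuousAt
    have c0 : ContinuousAt (fun r : ℝ => wS ρ β 0 (r ^ 2)) r :=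
      ((wS_cont ρ β hρ hβ 0).comp (continuous_pow 2)).continuousAt
    exact continuousAt_const.add (continuousAt_const.mul (c1.div c0 hr))
  have hlim0 : Tendsto G (nhdsWithin 0 (Ioi 0)) (nhds 1) := by
    have := (hcontAt 0 (by norm_num [wS_zero_zero ρ β hβ])).tendsto
    have e : G 0 = 1 := by simp [hG, wS_one_zero]
    rw [e] at this
    exact this.mono_left nhdsWithin_le_nhds
  have hlim1 : Tendsto G (nhdsWithin ζ₁ (Iio ζ₁)) atBot := by
    rw [tendsto_atBot]
    intro b
    obtain ⟨B, hB⟩ := exists_nat_ge (1 - b)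
    obtain ⟨x, hx, hxB⟩ := w_unbdd hρ hβ hX0 hXz hX B
    have hs : Real.sqrt x < ζ₁ := (Real.sqrt_lt' hζ0).2 hx.2
    have hs0 : 0 < Real.sqrt x := Real.sqrt_pos.2 hx.1
    have hGs : G (Real.sqrt x) ≤ b := by
      simp only [hG]
      rw [Real.sq_sqrt hx.1.le]
      have : (0 : ℝ) ≤ B := Nat.cast_nonneg B
      linarith
    filter_upwards [Ioo_mem_nhdsLT hs] with r hr
    exact (hanti ⟨hs0, hs⟩ ⟨hs0.trans hr.1, hr.2⟩ hr.1).le.trans hGs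
  have hev0 : ∀ᶠ r in nhdsWithin (0 : ℝ) (Ioi 0), r ∈ Ioo 0 ζ₁ := Ioo_mem_nhdsGT hζ0
  have hev1 : ∀ᶠ r in nhdsWithin ζ₁ (Iio ζ₁), r ∈ Ioo 0 ζ₁ := Ioo_mem_nhdsLT hζ0
  refine ⟨?_, ?_, ?_, ?_⟩
  · intro a ha b hb hab
    simp only
    rw [hRre a ha, hRre b hb]
    exact hanti ha hb hab
  · exact hlim0.congr' (hev0.mono fun r hr => (hRre r hr).symm)
  · exact hlim1.congr' (hev1.mono fun r hr => (hRre r hr).symm)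
  · intro c hc
    obtain ⟨r1, hr1, hc1⟩ := (hev0.and (hlim0.eventually (lt_mem_nhds hc))).exists
    obtain ⟨r2, hr2, hc2⟩ := (hev1.and (hlim1.eventually (eventually_lt_atBot c))).exists
    have hcont : ContinuousOn G (Ioo 0 ζ₁) := fun r hr =>
      (hcontAt r (hX _ (hmem r hr).1 (hmem r hr).2)).continuousWithinAt
    obtain ⟨r, hr, hrc⟩ := isPreconnected_Ioo.intermediate_value hr2 hr1 hcont ⟨hc2.le, hc1.le⟩
    refine ⟨r, ⟨hr, by rw [hR r hr, hrc]⟩, ?_⟩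
    rintro s ⟨hs, hsc⟩
    rw [hR s hs] at hsc
    have : G s = c := by exact_mod_cast hsc
    exact hanti.injOn hs hr (this.trans hrc.symm)
end
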